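/- The duality operations commute with Harish-Chandra induction: for all n₁, n₂ ≥ 1 and invariant functions f₁ ∈ C_{n₁}, f₂ ∈ C_{n₂}, one has 𝒟_{n₁+n₂}(R^{n₁+n₂}_{n₁,n₂}(f₁ ⊠ f₂)) = R^{n₁+n₂}_{n₁,n₂}(𝒟_{n₁}(f₁) ⊠ 𝒟_{n₂}(f₂)). -/

import Mathlib

open Matrix BigOperators

namespace HCPaper

open scoped Classical

/-- `gl F n` : the additive group of `n × n` matrices over `F`. -/
abbrev gl (F : Type) (n : ℕ) := Matrix (Fin n) (Fin n) F

variable {F : Type} [Field F] [Fintype F] [DecidableEq F]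

/-- Conjugation (adjoint) action of `GL_n(F)` on `gl_n(F)`. -/
def conjM {n : ℕ} (g : Matrix.GeneralLinearGroup (Fin n) F) (x : gl F n) : gl F n :=
  (g : Matrix (Fin n) (Fin n) F) * x * ((g⁻¹ : Matrix.GeneralLinearGroup (Fin n) F) : Matrix (Fin n) (Fin n) F)

/-- A function `f : gl_n(F) → ℂ` is invariant if it is constant on `GL_n(F)`-conjugacy orbits. -/
def Invariant (n : ℕ) (f : gl F n → ℂ) : Prop :=
  ∀ (g : Matrix.GeneralLinearGroup (Fin n) F) (x : gl F n), f (conjM g x) = f x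

/-- Invariance for functions on `gl_k(F) × gl_l(F)` under `GL_k(F) × GL_l(F)`. -/
def Invariant₂ (k l : ℕ) (h : gl F k × gl F l → ℂ) : Prop :=
  ∀ (g₁ : Matrix.GeneralLinearGroup (Fin k) F) (g₂ : Matrix.GeneralLinearGroup (Fin l) F)
    (x : gl F k) (y : gl F l), h (conjM g₁ x, conjM g₂ y) = h (x, y)

/-- Transport of matrices along an equality of sizes. -/
def castM {m n : ℕ} (h : m = n) (x : gl F m) : gl F n :=
  Matrix.reindex (finCongr h) (finCongr h) x

/-- Transport of functions along an equality of sizes. -/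
def castFun {m n : ℕ} (h : m = n) (f : gl F m → ℂ) : gl F n → ℂ :=
  fun x => f (castM h.symm x)

/-- The block upper-triangular matrix `[x u; 0 y]`, viewed in `gl_{k+l}(F)`. -/
def but (k l : ℕ) (x : gl F k) (u : Matrix (Fin k) (Fin l) F) (y : gl F l) : gl F (k + l) :=
  Matrix.reindex finSumFinEquiv finSumFinEquiv (Matrix.fromBlocks x u 0 y)

/-- The block lower-triangular matrix `[x 0; v y]`, viewed in `gl_{k+l}(F)`. -/
def blt (k l : ℕ) (x : gl F k) (v : Matrix (Fin l) (Fin k) F) (y : gl F l) : gl F (k + l) :=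
  Matrix.reindex finSumFinEquiv finSumFinEquiv (Matrix.fromBlocks x 0 v y)

/-- View a matrix in `gl_{k+l}(F)` as a `2 × 2`-block matrix. -/
def blk (k l : ℕ) (m : gl F (k + l)) : Matrix (Fin k ⊕ Fin l) (Fin k ⊕ Fin l) F :=
  Matrix.reindex finSumFinEquiv.symm finSumFinEquiv.symm m

/-- Membership in `P_{k,l}` : being block upper triangular with blocks of sizes `k, l`. -/
def IsBUT (k l : ℕ) (m : gl F (k + l)) : Prop := Matrix.toBlocks₂₁ (blk k l m) = 0

/-- The projection `π : P_{k,l} → gl_k(F) × gl_l(F)` deleting the off-diagonal block. -/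
def proj (k l : ℕ) (m : gl F (k + l)) : gl F k × gl F l :=
  (Matrix.toBlocks₁₁ (blk k l m), Matrix.toBlocks₂₂ (blk k l m))

/-- The order of the group `P^×_{k,l}` of invertible block upper-triangular matrices. -/
noncomputable def Pcard (F : Type) [Field F] [Fintype F] [DecidableEq F] (k l : ℕ) : ℕ :=
  Nat.card {g : Matrix.GeneralLinearGroup (Fin (k + l)) F //
    IsBUT k l (g : Matrix (Fin (k + l)) (Fin (k + l)) F)}

/-- Harish-Chandra restriction `*R^{k+l}_{k,l}`; by convention it is the identity
(under the canonical identifications) when `k = 0` or `l = 0`. -/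
noncomputable def HCres (k l : ℕ) (f : gl F (k + l) → ℂ) : gl F k × gl F l → ℂ :=
  if hk : k = 0 then fun p => f (castM (by omega) p.2)
  else if hl : l = 0 then fun p => f (castM (by omega) p.1)
  else fun p =>
    ((Fintype.card F : ℂ) ^ (k * l))⁻¹ * ∑ u : Matrix (Fin k) (Fin l) F, f (but k l p.1 u p.2)

/-- Harish-Chandra induction `R^{k+l}_{k,l}`; by convention it is the identity
(under the canonical identifications) when `k = 0` or `l = 0`. -/
noncomputable def HCind (k l : ℕ) (h : gl F k × gl F l → ℂ) : gl F (k + l) → ℂ :=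
  if hk : k = 0 then fun z => h (0, castM (by omega) z)
  else if hl : l = 0 then fun z => h (castM (by omega) z, 0)
  else fun z =>
    ((Pcard F k l : ℂ))⁻¹ *
      ∑ g : Matrix.GeneralLinearGroup (Fin (k + l)) F,
        if IsBUT k l (conjM g z) then h (proj k l (conjM g z)) else 0

/-- The hermitian inner product on `C_n`. -/
noncomputable def inn (n : ℕ) (f g : gl F n → ℂ) : ℂ :=
  ((Fintype.card (Matrix.GeneralLinearGroup (Fin n) F) : ℂ))⁻¹ *
    ∑ x : gl F n, f x * (starRingEnd ℂ) (g x)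

/-- The hermitian inner product on invariant functions on `gl_k(F) × gl_l(F)`. -/
noncomputable def inn₂ (k l : ℕ) (f g : gl F k × gl F l → ℂ) : ℂ :=
  ((Fintype.card (Matrix.GeneralLinearGroup (Fin k) F) *
      Fintype.card (Matrix.GeneralLinearGroup (Fin l) F) : ℂ))⁻¹ *
    ∑ p : gl F k × gl F l, f p * (starRingEnd ℂ) (g p)

/-- `f ∈ C_n` is pre-cuspidal if all proper Harish-Chandra restrictions of `f` vanish. -/
def PreCuspidal (n : ℕ) (f : gl F n → ℂ) : Prop :=
  ∀ (k l : ℕ), 1 ≤ k → 1 ≤ l → ∀ hkl : k + l = n, HCres k l (castFun hkl.symm f) = 0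

/-- The composite `R_{(n_1,…,n_r)} ∘ *R_{(n_1,…,n_r)}` of the iterated two-block
Harish-Chandra induction and restriction along the composition `(n_1,…,n_r)`. -/
noncomputable def RcompRes : (L : List ℕ) → (gl F L.sum → ℂ) → gl F L.sum → ℂ
  | [], f => f
  | (k :: L), f =>
      castFun (List.sum_cons).symm
        (HCind k L.sum fun p =>
          RcompRes L (fun y => HCres k L.sum (castFun List.sum_cons f) (p.1, y)) p.2)

/-- The duality operation `𝒟_n(f) = Σ_{(n_1,…,n_r) ⊨ n} (-1)^{n-r}
R_{(n_1,…,n_r)}(*R_{(n_1,…,n_r)} f)`, the sum over all compositions of `n`. -/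
noncomputable def Dual (n : ℕ) (f : gl F n → ℂ) : gl F n → ℂ :=
  ∑ c : Composition n,
    ((-1 : ℂ)) ^ (n - c.length) •
      castFun c.blocks_sum (RcompRes c.blocks (castFun c.blocks_sum.symm f))

/-- `C_n`, the subspace of invariant functions, as a `ℂ`-submodule of all functions. -/
noncomputable def InvSub (F : Type) [Field F] (n : ℕ) : Submodule ℂ (gl F n → ℂ) where
  carrier := {f | Invariant n f}
  add_mem' := by
    intro a b ha hb g x
    simp only [Pi.add_apply]
    rw [ha g x, hb g x]
  zero_mem' := by intro g x; rfl
  smul_mem' := by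
    intro c f hf g x
    simp only [Pi.smul_apply]
    rw [hf g x]

/-- `χ` is the character of a finite-dimensional complex representation of the
additive group `gl_n(F)`. -/
def IsChar (n : ℕ) (χ : gl F n → ℂ) : Prop :=
  ∃ V : FDRep ℂ (Multiplicative (gl F n)),
    ∀ x : gl F n, FDRep.character V (Multiplicative.ofAdd x) = χ x

/-- An invariant character of `gl_n(F)`. -/
def IsInvChar (n : ℕ) (χ : gl F n → ℂ) : Prop := IsChar n χ ∧ Invariant n χ

/-- A character of the additive group `gl_k(F) × gl_l(F)`. -/
def IsChar₂ (k l : ℕ) (χ : gl F k × gl F l → ℂ) : Prop :=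
  ∃ V : FDRep ℂ (Multiplicative (gl F k × gl F l)),
    ∀ p : gl F k × gl F l, FDRep.character V (Multiplicative.ofAdd p) = χ p

/-- An invariant character of `gl_k(F) × gl_l(F)`. -/
def IsInvChar₂ (k l : ℕ) (χ : gl F k × gl F l → ℂ) : Prop := IsChar₂ k l χ ∧ Invariant₂ k l χ

/-- An irreducible invariant character: a nonzero invariant character which is not
the sum of two nonzero invariant characters. -/
def IrrInvChar (n : ℕ) (χ : gl F n → ℂ) : Prop :=
  IsInvChar n χ ∧ χ ≠ 0 ∧
    ¬ ∃ χ₁ χ₂ : gl F n → ℂ, IsInvChar n χ₁ ∧ IsInvChar n χ₂ ∧ χ₁ ≠ 0 ∧ χ₂ ≠ 0 ∧ χ = χ₁ + χ₂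


end HCPaper

section
open Matrix BigOperators
namespace HCPaper
open scoped Classical
variable {F : Type} [Field F]

/-! ### Objects: finite vector spaces with an endomorphism -/

structure Obj (F : Type) [Field F] where
  V : Type
  [ac : AddCommGroup V]
  [mo : Module F V]
  [fi : Finite V]
  x : V →ₗ[F] V

attribute [instance] Obj.ac Obj.mo Obj.fi

instance finHom {V W : Type} [AddCommGroup V] [Module F V] [AddCommGroup W] [Module F W]
    [Finite V] [Finite W] : Finite (V →ₗ[F] W) := DFunLike.finite _

instance finQuot {V : Type} [AddCommGroup V] [Module F V] [Finite V] (p : Submodule F V) :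
    Finite (V ⧸ p) := Finite.of_surjective _ p.mkQ_surjective

noncomputable instance ftHom {V W : Type} [AddCommGroup V] [Module F V] [AddCommGroup W]
    [Module F W] [Finite V] [Finite W] : Fintype (V →ₗ[F] W) := Fintype.ofFinite _

noncomputable instance ftSub {V : Type} [AddCommGroup V] [Module F V] [Finite V] :
    Fintype (Submodule F V) := Fintype.ofFinite _

def IsIso (X Y : Obj F) : Prop := ∃ e : X.V ≃ₗ[F] Y.V, ∀ v, e (X.x v) = Y.x (e v)

theorem IsIso.refl (X : Obj F) : IsIso X X := ⟨LinearEquiv.refl _ _, fun _ => rfl⟩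

theorem IsIso.symm {X Y : Obj F} (h : IsIso X Y) : IsIso Y X := by
  obtain ⟨e, he⟩ := h
  refine ⟨e.symm, fun v => ?_⟩
  apply e.injective
  rw [he]; simp

theorem IsIso.trans {X Y Z : Obj F} (h : IsIso X Y) (h' : IsIso Y Z) : IsIso X Z := by
  obtain ⟨e, he⟩ := h
  obtain ⟨e', he'⟩ := h'
  exact ⟨e.trans e', fun v => by simp [he, he']⟩

def Inv (f : Obj F → ℂ) : Prop := ∀ X Y, IsIso X Y → f X = f Y
def Inv2 (P : Obj F → Obj F → ℂ) : Prop :=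
  ∀ A A' B B', IsIso A A' → IsIso B B' → P A B = P A' B'

def Stb (X : Obj F) (W : Submodule F X.V) : Prop := ∀ v ∈ W, X.x v ∈ W

def sub (X : Obj F) (W : Submodule F X.V) (h : Stb X W) : Obj F := ⟨W, X.x.restrict h⟩
def quo (X : Obj F) (W : Submodule F X.V) (h : Stb X W) : Obj F := ⟨X.V ⧸ W, W.mapQ W X.x h⟩

noncomputable def term (P : Obj F → Obj F → ℂ) (X : Obj F) (W : Submodule F X.V) : ℂ :=
  if h : Stb X W then P (sub X W h) (quo X W h) else 0

theorem term_pos (P : Obj F → Obj F → ℂ) (X : Obj F) (W : Submodule F X.V) (h : Stb X W) :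
    term P X W = P (sub X W h) (quo X W h) := dif_pos h

theorem term_neg (P : Obj F → Obj F → ℂ) (X : Obj F) (W : Submodule F X.V) (h : ¬ Stb X W) :
    term P X W = 0 := dif_neg h

noncomputable def mulP (P : Obj F → Obj F → ℂ) (X : Obj F) : ℂ := ∑ W, term P X W

noncomputable def mul (f g : Obj F → ℂ) : Obj F → ℂ := mulP (fun A B => f A * g B)

theorem term_map {P : Obj F → Obj F → ℂ} (hP : Inv2 P) {X Y : Obj F} (e : X.V ≃ₗ[F] Y.V)
    (he : ∀ v, e (X.x v) = Y.x (e v)) (W : Submodule F X.V) (W' : Submodule F Y.V)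
    (hW : ∀ v, e v ∈ W' ↔ v ∈ W) :
    term P X W = term P Y W' := by
  have hs : Stb X W ↔ Stb Y W' := by
    constructor
    · intro h v hv
      obtain ⟨w, rfl⟩ := e.surjective v
      rw [← he, hW]; exact h _ ((hW _).1 hv)
    · intro h v hv
      rw [← hW, he]; exact h _ ((hW _).2 hv)
  have hm : W.map (e : X.V →ₗ[F] Y.V) = W' := by
    ext y
    obtain ⟨w, rfl⟩ := e.surjective y
    simp [hW]
  by_cases h : Stb X W
  · have h' := hs.1 h
    rw [term, term, dif_pos h, dif_pos h']
    apply hP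
    · refine ⟨(e.submoduleMap W).trans (LinearEquiv.ofEq _ _ hm), ?_⟩
      intro v
      apply Subtype.ext
      exact he v.1
    · refine ⟨Submodule.Quotient.equiv W W' e hm, ?_⟩
      intro v
      obtain ⟨w, rfl⟩ := Submodule.Quotient.mk_surjective _ v
      exact congrArg (Submodule.Quotient.mk (p := W')) (he w)
  · rw [term, term, dif_neg h, dif_neg (fun h' => h (hs.2 h'))]

theorem mulP_inv {P : Obj F → Obj F → ℂ} (hP : Inv2 P) : Inv (mulP P) := by
  rintro X Y ⟨e, he⟩
  refine Fintype.sum_equiv (Submodule.orderIsoMapComap e).toEquiv _ _ fun W => ?_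
  apply term_map hP e he
  intro v
  simp

theorem Inv.mul2 {f g : Obj F → ℂ} (hf : Inv f) (hg : Inv g) :
    Inv2 (fun A B => f A * g B) := by
  intro A A' B B' h h'
  simp only [hf _ _ h, hg _ _ h']

theorem mul_inv' {f g : Obj F → ℂ} (hf : Inv f) (hg : Inv g) : Inv (mul f g) :=
  mulP_inv (hf.mul2 hg)

/-! ### Associativity -/

def Inv3 (K : Obj F → Obj F → Obj F → ℂ) : Prop :=
  ∀ A A' B B' C C', IsIso A A' → IsIso B B' → IsIso C C' → K A B C = K A' B' C'

theorem sum_sub {V : Type} [AddCommGroup V] [Module F V] [Finite V] (M : Submodule F V)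
    (k : Submodule F M → ℂ) :
    ∑ A, k A = ∑ A : Submodule F V, if A ≤ M then k (A.comap M.subtype) else 0 := by
  rw [← Finset.sum_filter]
  refine Finset.sum_bij' (fun A _ => A.map M.subtype) (fun A _ => A.comap M.subtype) ?_ ?_ ?_ ?_ ?_
  · intro A _; simp [Submodule.map_subtype_le]
  · intro A _; exact Finset.mem_univ _
  · intro A _; exact Submodule.comap_map_eq_of_injective M.injective_subtype A
  · intro A hA
    simp only [Finset.mem_filter, Finset.mem_univ, true_and] at hA
    simpa using hA
  · intro A _; rw [Submodule.comap_map_eq_of_injective M.injective_subtype A]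

theorem sum_quo {V : Type} [AddCommGroup V] [Module F V] [Finite V] (A : Submodule F V)
    (k : Submodule F (V ⧸ A) → ℂ) :
    ∑ B, k B = ∑ M : Submodule F V, if A ≤ M then k (M.map A.mkQ) else 0 := by
  rw [← Finset.sum_filter]
  refine Finset.sum_bij' (fun B _ => B.comap A.mkQ) (fun M _ => M.map A.mkQ) ?_ ?_ ?_ ?_ ?_
  · intro B _; simp [Submodule.le_comap_mkQ]
  · intro M _; exact Finset.mem_univ _
  · intro B _; exact Submodule.map_comap_eq_of_surjective A.mkQ_surjective _
  · intro M hM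
    simp only [Finset.mem_filter, Finset.mem_univ, true_and] at hM
    simpa using hM
  · intro B _; rw [Submodule.map_comap_eq_of_surjective A.mkQ_surjective]


theorem assoc {K : Obj F → Obj F → Obj F → ℂ} (hK : Inv3 K) (X : Obj F) :
    mulP (fun M C => mulP (fun A B => K A B C) M) X =
    mulP (fun A Y => mulP (fun B C => K A B C) Y) X := by
  have h1 : mulP (fun M C => mulP (fun A B => K A B C) M) X =
      ∑ M : Submodule F X.V, ∑ A : Submodule F X.V, if hs : Stb X M ∧ A ≤ M then
        term (fun A B => K A B (quo X M hs.1)) (sub X M hs.1) (A.comap M.subtype) else 0 := by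
    refine Finset.sum_congr rfl fun M _ => ?_
    by_cases h : Stb X M
    · rw [term, dif_pos h]
      refine (sum_sub M _).trans ?_
      refine Finset.sum_congr rfl fun A _ => ?_
      by_cases hA : A ≤ M
      · rw [if_pos hA, dif_pos (show _ ∧ _ from ⟨h, hA⟩)]; rfl
      · rw [if_neg hA, dif_neg (fun t => hA t.2)]
    · rw [term, dif_neg h, Finset.sum_eq_zero]
      intro A _
      rw [dif_neg (fun t => h t.1)]
  have h2 : mulP (fun A Y => mulP (fun B C => K A B C) Y) X =
      ∑ A : Submodule F X.V, ∑ M : Submodule F X.V, if hs : Stb X A ∧ A ≤ M then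
        term (fun B C => K (sub X A hs.1) B C) (quo X A hs.1) (M.map A.mkQ) else 0 := by
    refine Finset.sum_congr rfl fun A _ => ?_
    by_cases h : Stb X A
    · rw [term, dif_pos h]
      refine (sum_quo A _).trans ?_
      refine Finset.sum_congr rfl fun M _ => ?_
      by_cases hA : A ≤ M
      · rw [if_pos hA, dif_pos (show _ ∧ _ from ⟨h, hA⟩)]; rfl
      · rw [if_neg hA, dif_neg (fun t => hA t.2)]
    · rw [term, dif_neg h, Finset.sum_eq_zero]
      intro M _
      rw [dif_neg (fun t => h t.1)]
  rw [h1, h2, Finset.sum_comm]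
  refine Finset.sum_congr rfl fun A _ => Finset.sum_congr rfl fun M _ => ?_
  by_cases hAM : A ≤ M
  swap
  · rw [dif_neg (fun t => hAM t.2), dif_neg (fun t => hAM t.2)]
  by_cases hA : Stb X A
  · by_cases hM : Stb X M
    · have hA' : Stb (sub X M hM) (A.comap M.subtype) := fun v hv => hA _ hv
      have hM' : Stb (quo X A hA) (M.map A.mkQ) := by
        rintro _ ⟨v, hv, rfl⟩
        exact ⟨X.x v, hM _ hv, rfl⟩
      rw [dif_pos ⟨hM, hAM⟩, dif_pos ⟨hA, hAM⟩, term, term, dif_pos hA', dif_pos hM']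
      apply hK
      · refine ⟨Submodule.comapSubtypeEquivOfLe hAM, fun v => rfl⟩
      · let φ : M →ₗ[F] (M.map A.mkQ) := A.mkQ.restrict (fun v hv => ⟨v, hv, rfl⟩)
        have hφ : Function.Surjective φ := by
          rintro ⟨_, v, hv, rfl⟩
          exact ⟨⟨v, hv⟩, rfl⟩
        have hk : A.comap M.subtype = LinearMap.ker φ := by
          ext v
          rw [LinearMap.mem_ker, ← Subtype.coe_inj]
          change _ ↔ A.mkQ v.1 = 0
          simp
        refine ⟨(Submodule.quotEquivOfEq _ _ hk).trans (φ.quotKerEquivOfSurjective hφ), ?_⟩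
        intro v
        obtain ⟨w, rfl⟩ := Submodule.Quotient.mk_surjective _ v
        rfl
      · refine IsIso.symm ⟨Submodule.quotientQuotientEquivQuotient A M hAM, ?_⟩
        intro v
        obtain ⟨w, rfl⟩ := Submodule.Quotient.mk_surjective _ v
        obtain ⟨w, rfl⟩ := Submodule.Quotient.mk_surjective _ w
        rfl
    · rw [dif_neg (fun t => hM t.1), dif_pos ⟨hA, hAM⟩, term, dif_neg]
      intro h
      apply hM
      intro v hv
      obtain ⟨w, hw, hw'⟩ := h (A.mkQ v) ⟨v, hv, rfl⟩
      have : A.mkQ w = A.mkQ (X.x v) := hw'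
      rw [← sub_eq_zero, ← map_sub, Submodule.mkQ_apply, Submodule.Quotient.mk_eq_zero] at this
      have := M.sub_mem hw (hAM this)
      simpa using this
  · rw [dif_neg (fun t : Stb X A ∧ A ≤ M => hA t.1)]
    by_cases hM : Stb X M
    · rw [dif_pos ⟨hM, hAM⟩, term, dif_neg]
      intro h
      exact hA fun v hv => h ⟨v, hAM hv⟩ hv
    · rw [dif_neg (fun t => hM t.1)]

end HCPaper
end

section
open Matrix BigOperators
namespace HCPaper
open scoped Classical
variable {F : Type} [Field F]

/-! ### Averages -/

noncomputable def avg {α : Type} [Finite α] (k : α → ℂ) : ℂ :=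
  (Nat.card α : ℂ)⁻¹ * ∑ᶠ a, k a

theorem avg_eq {α : Type} [Fintype α] (k : α → ℂ) :
    avg k = (Fintype.card α : ℂ)⁻¹ * ∑ a, k a := by
  rw [avg, finsum_eq_sum_of_fintype, Nat.card_eq_fintype_card]

theorem avg_equiv {α β : Type} [Finite α] [Finite β] (e : α ≃ β) (k : α → ℂ) (k' : β → ℂ)
    (h : ∀ a, k a = k' (e a)) : avg k = avg k' := by
  have := Fintype.ofFinite α
  have := Fintype.ofFinite β
  rw [avg_eq, avg_eq, Fintype.card_congr e, Fintype.sum_equiv e k k' h]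

theorem avg_congr {α : Type} [Finite α] (k k' : α → ℂ)
    (h : ∀ a, k a = k' a) : avg k = avg k' := avg_equiv (Equiv.refl α) k k' h

theorem avg_sum {α ι : Type} [Finite α] (s : Finset ι) (k : ι → α → ℂ) :
    avg (fun a => ∑ i ∈ s, k i a) = ∑ i ∈ s, avg (k i) := by
  have := Fintype.ofFinite α
  simp only [avg_eq]
  rw [Finset.sum_comm, Finset.mul_sum]

theorem avg_mul {α : Type} [Finite α] (c : ℂ) (k : α → ℂ) :
    avg (fun a => c * k a) = c * avg k := by
  have := Fintype.ofFinite α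
  simp only [avg_eq]
  rw [← Finset.mul_sum]; ring

theorem avg_prod {α β : Type} [Finite α] [Finite β] (k : α → ℂ) (k' : β → ℂ) :
    avg (fun p : α × β => k p.1 * k' p.2) = avg k * avg k' := by
  have := Fintype.ofFinite α
  have := Fintype.ofFinite β
  simp only [avg_eq]
  rw [Fintype.sum_prod_type, Fintype.card_prod]
  simp only [← Finset.mul_sum, ← Finset.sum_mul]
  push_cast
  rw [mul_inv]; ring

theorem avg_unique {α : Type} [Unique α] (k : α → ℂ) : avg k = k default := by
  rw [avg_eq]; simp

theorem avg_surj {G G' : Type} [AddGroup G] [AddGroup G'] [Finite G] [Finite G'] (π : G →+ G')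
    (hπ : Function.Surjective π) (k : G' → ℂ) : avg (fun a => k (π a)) = avg k := by
  have := Fintype.ofFinite G
  have := Fintype.ofFinite G'
  have hf : ∀ b : G', (Finset.univ.filter (fun a => π a = b)).card =
      (Finset.univ.filter (fun a => π a = 0)).card := by
    intro b
    obtain ⟨a₀, rfl⟩ := hπ b
    refine Finset.card_bij' (fun a _ => a - a₀) (fun a _ => a + a₀) ?_ ?_ ?_ ?_ <;> simp +contextual [sub_eq_zero]
  have hc : ∀ k : G' → ℂ, ∑ a, k (π a) =
      ((Finset.univ.filter (fun a => π a = 0)).card : ℂ) * ∑ b, k b := by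
    intro k
    rw [← Finset.sum_fiberwise_of_maps_to (s := Finset.univ) (t := Finset.univ) (g := π)
      (fun _ _ => Finset.mem_univ _), Finset.mul_sum]
    refine Finset.sum_congr rfl fun b _ => ?_
    rw [Finset.sum_congr rfl (g := fun _ => k b) (by
      intro a ha; rw [(Finset.mem_filter.1 ha).2]), Finset.sum_const, hf, nsmul_eq_mul]
  have h1 := hc (fun _ => 1)
  simp only [Finset.sum_const, Finset.card_univ, nsmul_eq_mul, mul_one] at h1
  have h0 : (Fintype.card G : ℂ) ≠ 0 := by exact_mod_cast Fintype.card_ne_zero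
  rw [avg_eq, avg_eq, hc, h1]
  rw [h1] at h0
  have := left_ne_zero_of_mul h0
  have := right_ne_zero_of_mul h0
  field_simp

/-! ### Extensions and the coproduct -/

def ext (M N : Obj F) (u : N.V →ₗ[F] M.V) : Obj F :=
  ⟨M.V × N.V, LinearMap.prod (M.x ∘ₗ LinearMap.fst F M.V N.V + u ∘ₗ LinearMap.snd F M.V N.V)
    (N.x ∘ₗ LinearMap.snd F M.V N.V)⟩

theorem ext_x (M N : Obj F) (u : N.V →ₗ[F] M.V) (p : M.V × N.V) :
    (ext M N u).x p = ((M.x p.1 + u p.2, N.x p.2) : M.V × N.V) := rfl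

noncomputable def Dl (f : Obj F → ℂ) (M N : Obj F) : ℂ := avg (fun u => f (ext M N u))

theorem Dl_inv {f : Obj F → ℂ} (hf : Inv f) : Inv2 (Dl f) := by
  rintro A A' B B' ⟨e, he⟩ ⟨e', he'⟩
  refine avg_equiv (LinearEquiv.arrowCongr e' e).toEquiv _ _ fun u => hf _ _ ?_
  refine ⟨e.prodCongr e', ?_⟩
  rintro ⟨a, b⟩
  refine Prod.ext ?_ ?_
  · change e (A.x a + u b) = A'.x (e a) + e (u (e'.symm (e' b)))
    simp [he]
  · exact he' b

theorem Dl_sum {ι : Type} (s : Finset ι) (f : ι → Obj F → ℂ) (M N : Obj F) :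
    Dl (fun X => ∑ i ∈ s, f i X) M N = ∑ i ∈ s, Dl (f i) M N := avg_sum s _

/-! ### The Mackey formula -/

section mackey
variable {M N : Type} [AddCommGroup M] [Module F M] [AddCommGroup N] [Module F N]

def Tm (A : Submodule F M) (B : Submodule F N) (φ : N →ₗ[F] M) : Submodule F (M × N) :=
  (A.prod B).comap (LinearMap.prod (LinearMap.fst F M N - φ ∘ₗ LinearMap.snd F M N)
    (LinearMap.snd F M N))

theorem mem_Tm (A : Submodule F M) (B : Submodule F N) (φ : N →ₗ[F] M) (p : M × N) :
    p ∈ Tm A B φ ↔ p.1 - φ p.2 ∈ A ∧ p.2 ∈ B := by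
  simp [Tm]

abbrev HH (A : Submodule F M) (B : Submodule F N) : Submodule F (N →ₗ[F] M) :=
  Submodule.compatibleMaps B A

theorem mem_HH (A : Submodule F M) (B : Submodule F N) (φ : N →ₗ[F] M) :
    φ ∈ HH A B ↔ ∀ b ∈ B, φ b ∈ A := Iff.rfl

theorem Tm_A (A : Submodule F M) (B : Submodule F N) (φ : N →ₗ[F] M) :
    (Tm A B φ).comap (LinearMap.inl F M N) = A := by
  ext m; simp [mem_Tm]

theorem Tm_B (A : Submodule F M) (B : Submodule F N) (φ : N →ₗ[F] M) :
    (Tm A B φ).map (LinearMap.snd F M N) = B := by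
  ext n
  simp only [Submodule.mem_map, mem_Tm, LinearMap.snd_apply]
  constructor
  · rintro ⟨p, hp, rfl⟩; exact hp.2
  · intro h; exact ⟨(φ n, n), by simpa using h, rfl⟩

theorem Tm_eq_iff (A : Submodule F M) (B : Submodule F N) (φ ψ : N →ₗ[F] M) :
    Tm A B φ = Tm A B ψ ↔ φ - ψ ∈ HH A B := by
  rw [mem_HH]
  constructor
  · intro h b hb
    have : ((φ b, b) : M × N) ∈ Tm A B φ := by simpa [mem_Tm] using hb
    rw [h, mem_Tm] at this
    exact this.1
  · intro h
    ext ⟨m, n⟩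
    simp only [mem_Tm]
    refine and_congr_left fun hn => ?_
    have := h n hn
    rw [LinearMap.sub_apply] at this
    rw [show m - ψ n = (m - φ n) + (φ n - ψ n) by abel]
    exact (Submodule.add_mem_iff_left A this).symm

theorem Tm_surj (W : Submodule F (M × N)) :
    ∃ φ, Tm (W.comap (LinearMap.inl F M N)) (W.map (LinearMap.snd F M N)) φ = W := by
  set B := W.map (LinearMap.snd F M N)
  let p : W →ₗ[F] B := (LinearMap.snd F M N).restrict (fun v hv => ⟨v, hv, rfl⟩)
  have hp : LinearMap.range p = ⊤ := by
    rw [LinearMap.range_eq_top]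
    rintro ⟨_, v, hv, rfl⟩
    exact ⟨⟨v, hv⟩, rfl⟩
  obtain ⟨s, hs⟩ := p.exists_rightInverse_of_surjective hp
  obtain ⟨φ, hφ⟩ := LinearMap.exists_extend (LinearMap.fst F M N ∘ₗ W.subtype ∘ₗ s)
  have key : ∀ b (hb : b ∈ B), ((φ b, b) : M × N) ∈ W := by
    intro b hb
    have h1 : φ b = (s ⟨b, hb⟩).1.1 := LinearMap.congr_fun hφ ⟨b, hb⟩
    have h2 : b = (s ⟨b, hb⟩).1.2 := by
      have := LinearMap.congr_fun hs ⟨b, hb⟩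
      exact (congrArg Subtype.val this).symm
    have h3 := (s ⟨b, hb⟩).2
    have h4 : ((φ b, b) : M × N) = (s ⟨b, hb⟩).1 := Prod.ext h1 h2
    rw [h4]; exact h3
  refine ⟨φ, ?_⟩
  ext ⟨m, n⟩
  simp only [mem_Tm, Submodule.mem_comap, LinearMap.inl_apply]
  constructor
  · rintro ⟨h1, h2⟩
    have := W.add_mem h1 (key n h2)
    simpa using this
  · intro h
    have hn : n ∈ B := ⟨_, h, rfl⟩
    refine ⟨?_, hn⟩
    have := W.sub_mem h (key n hn)
    simpa using this

theorem key_sum [Finite M] [Finite N] (G : Submodule F (M × N) → ℂ) :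
    ∑ W, G W = ∑ A : Submodule F M, ∑ B : Submodule F N,
      (Nat.card (HH A B) : ℂ)⁻¹ * ∑ φ : N →ₗ[F] M, G (Tm A B φ) := by
  rw [← Finset.sum_fiberwise_of_maps_to (s := Finset.univ) (t := Finset.univ)
    (g := fun W : Submodule F (M × N) =>
      (W.comap (LinearMap.inl F M N), W.map (LinearMap.snd F M N)))
    (fun _ _ => Finset.mem_univ _), Fintype.sum_prod_type]
  refine Finset.sum_congr rfl fun A _ => Finset.sum_congr rfl fun B _ => ?_
  rw [← Finset.sum_fiberwise_of_maps_to (s := Finset.univ) (g := fun φ => Tm A B φ)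
    (t := Finset.univ.filter (fun W : Submodule F (M × N) =>
      (W.comap (LinearMap.inl F M N), W.map (LinearMap.snd F M N)) = (A, B)))
    (by intro φ _; simp [Tm_A, Tm_B]), Finset.mul_sum]
  refine Finset.sum_congr rfl fun W hW => ?_
  simp only [Finset.mem_filter, Finset.mem_univ, true_and, Prod.mk.injEq] at hW
  obtain ⟨φ₀, h₀⟩ := Tm_surj W
  rw [hW.1, hW.2] at h₀
  rw [Finset.sum_congr rfl (g := fun _ => G W) (by
      intro a ha; rw [(Finset.mem_filter.1 ha).2]), Finset.sum_const, nsmul_eq_mul]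
  have hc : (Finset.univ.filter (fun φ => Tm A B φ = W)).card = Nat.card (HH A B) := by
    rw [← Fintype.card_subtype, ← Nat.card_eq_fintype_card]
    refine Nat.card_congr ⟨fun φ => ⟨φ.1 - φ₀, ?_⟩, fun h => ⟨h.1 + φ₀, ?_⟩, ?_, ?_⟩
    · rw [← Tm_eq_iff, h₀]; exact φ.2
    · change Tm A B _ = W
      rw [← h₀, Tm_eq_iff]; simpa using h.2
    · intro φ; simp
    · intro φ; simp
  rw [hc, ← mul_assoc, inv_mul_cancel₀, one_mul]
  have : 0 < Nat.card (HH A B) := Nat.card_pos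
  exact_mod_cast this.ne'

end mackey

theorem mackey1 {P : Obj F → Obj F → ℂ} (hP : Inv2 P) (M N : Obj F)
    (A : Submodule F M.V) (B : Submodule F N.V) :
    avg (fun u => (Nat.card (HH A B) : ℂ)⁻¹ *
      ∑ φ : N.V →ₗ[F] M.V, term P (ext M N u) (Tm A B φ)) =
    (Nat.card (HH A B) : ℂ)⁻¹ * ∑ u : N.V →ₗ[F] M.V, term P (ext M N u) (Tm A B 0) := by
  rw [avg_mul]
  congr 1
  rw [avg_sum]
  have : ∀ φ : N.V →ₗ[F] M.V, avg (fun u => term P (ext M N u) (Tm A B φ)) =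
      avg (fun u => term P (ext M N u) (Tm A B 0)) := by
    intro φ
    refine avg_equiv (Equiv.addRight (M.x ∘ₗ φ - φ ∘ₗ N.x)) _ _ fun u => ?_
    symm
    let e : (M.V × N.V) ≃ₗ[F] (M.V × N.V) :=
      LinearEquiv.ofLinearMap
       (LinearMap.prod (LinearMap.fst F M.V N.V + φ ∘ₗ LinearMap.snd F M.V N.V)
        (LinearMap.snd F M.V N.V))
       (LinearMap.prod (LinearMap.fst F M.V N.V - φ ∘ₗ LinearMap.snd F M.V N.V)
        (LinearMap.snd F M.V N.V)) (by ext <;> simp) (by ext <;> simp)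
    have hee : ∀ p, e p = (p.1 + φ p.2, p.2) := fun p => rfl
    refine term_map hP (X := ext M N (u + (M.x ∘ₗ φ - φ ∘ₗ N.x))) (Y := ext M N u) e ?_ _ _ ?_
    · rintro ⟨m, n⟩
      rw [ext_x]
      refine (hee _).trans ?_
      refine Eq.trans ?_ (ext_x _ _ _ _).symm
      refine Prod.ext ?_ rfl
      change M.x m + (u n + (M.x (φ n) - φ (N.x n))) + φ (N.x n) = M.x (m + φ n) + u n
      rw [map_add]; abel
    · rintro ⟨m, n⟩
      change ((m + φ n, n) : M.V × N.V) ∈ Tm A B φ ↔ ((m, n) : M.V × N.V) ∈ Tm A B 0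
      simp [mem_Tm]
  rw [Finset.sum_congr rfl fun φ _ => this φ, Finset.sum_const, avg_eq, nsmul_eq_mul,
    Finset.card_univ, ← mul_assoc, mul_inv_cancel₀, one_mul]
  exact_mod_cast Fintype.card_ne_zero

noncomputable def resHom {M N : Type} [AddCommGroup M] [Module F M] [AddCommGroup N] [Module F N]
    (A : Submodule F M) (B : Submodule F N) :
    HH A B →+ (B →ₗ[F] A) × ((N ⧸ B) →ₗ[F] (M ⧸ A)) :=
  AddMonoidHom.mk' (fun u => (u.1.restrict u.2, B.mapQ A u.1 u.2)) (by
    intro a b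
    refine Prod.ext ?_ ?_
    · rfl
    · apply LinearMap.ext
      intro v
      obtain ⟨w, rfl⟩ := Submodule.Quotient.mk_surjective _ v
      rfl)

theorem resHom_surj {M N : Type} [AddCommGroup M] [Module F M] [AddCommGroup N] [Module F N]
    (A : Submodule F M) (B : Submodule F N) : Function.Surjective (resHom A B) := by
  rintro ⟨a, b⟩
  obtain ⟨a', ha'⟩ := LinearMap.exists_extend (A.subtype ∘ₗ a)
  obtain ⟨s, hs⟩ := A.mkQ.exists_rightInverse_of_surjective (Submodule.range_mkQ A)
  have h1 : ∀ (v : N) (hv : v ∈ B), a' v = a ⟨v, hv⟩ := fun v hv => LinearMap.congr_fun ha' ⟨v, hv⟩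
  have hs' : ∀ v, A.mkQ (s v) = v := fun v => LinearMap.congr_fun hs v
  let u : N →ₗ[F] M := a' + s ∘ₗ (b ∘ₗ B.mkQ - A.mkQ ∘ₗ a')
  have hu : ∀ (v : N) (hv : v ∈ B), u v = a ⟨v, hv⟩ := by
    intro v hv
    have e1 : B.mkQ v = 0 := by simpa using hv
    have e2 : A.mkQ (a' v) = 0 := by rw [h1 v hv]; simp
    change a' v + s (b (B.mkQ v) - A.mkQ (a' v)) = _
    rw [e1, e2, h1 v hv]; simp
  have hu2 : ∀ v, A.mkQ (u v) = b (B.mkQ v) := by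
    intro v
    change A.mkQ (a' v + s (b (B.mkQ v) - A.mkQ (a' v))) = _
    rw [map_add, hs']; abel
  refine ⟨⟨u, fun v hv => ?_⟩, ?_⟩
  · change u v ∈ A
    rw [hu v hv]; exact (a _).2
  · refine Prod.ext ?_ ?_
    · apply LinearMap.ext
      intro v
      exact Subtype.ext (hu v.1 v.2)
    · apply LinearMap.ext
      intro v
      obtain ⟨w, rfl⟩ := Submodule.Quotient.mk_surjective _ v
      exact hu2 w

theorem stb_iff (M N : Obj F) (A : Submodule F M.V) (B : Submodule F N.V) (u : N.V →ₗ[F] M.V) :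
    Stb (ext M N u) (Tm A B 0) ↔ (Stb M A ∧ Stb N B) ∧ u ∈ HH A B := by
  have key : ∀ m n, ((m, n) : M.V × N.V) ∈ Tm A B 0 ↔ m ∈ A ∧ n ∈ B := by
    intro m n; simp [mem_Tm]
  constructor
  · intro h
    have h' : ∀ m ∈ A, ∀ n ∈ B, M.x m + u n ∈ A ∧ N.x n ∈ B := by
      intro m hm n hn
      exact (key _ _).1 (h (m, n) ((key _ _).2 ⟨hm, hn⟩))
    refine ⟨⟨fun m hm => ?_, fun n hn => (h' 0 A.zero_mem n hn).2⟩, fun n hn => ?_⟩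
    · simpa using (h' m hm 0 B.zero_mem).1
    · simpa using (h' 0 A.zero_mem n hn).1
  · rintro ⟨⟨hA, hB⟩, hu⟩ ⟨m, n⟩ h
    have := (key m n).1 h
    exact (key _ _).2 ⟨A.add_mem (hA _ this.1) (hu this.2), hB _ this.2⟩

theorem ext_sub_iso (M N : Obj F) (A : Submodule F M.V) (B : Submodule F N.V)
    (hA : Stb M A) (hB : Stb N B) (u : HH A B) (h : Stb (ext M N u.1) (Tm A B 0)) :
    IsIso (ext (sub M A hA) (sub N B hB) (resHom A B u).1) (sub (ext M N u.1) (Tm A B 0) h) := by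
  let e : (A × B) →ₗ[F] (Tm A B (0 : N.V →ₗ[F] M.V)) :=
    LinearMap.codRestrict _ (A.subtype.prodMap B.subtype) (by
      rintro ⟨a, b⟩; simp [mem_Tm])
  have he : Function.Bijective e := by
    constructor
    · rintro ⟨a, b⟩ ⟨a', b'⟩ h
      have h1 := congrArg Subtype.val h
      exact Prod.ext (Subtype.ext (congrArg Prod.fst h1)) (Subtype.ext (congrArg Prod.snd h1))
    · rintro ⟨⟨m, n⟩, hp⟩
      rw [mem_Tm] at hp
      exact ⟨(⟨m, by simpa using hp.1⟩, ⟨n, hp.2⟩), rfl⟩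
  exact ⟨LinearEquiv.ofBijective e he, fun v => rfl⟩

theorem ext_quo_iso (M N : Obj F) (A : Submodule F M.V) (B : Submodule F N.V)
    (hA : Stb M A) (hB : Stb N B) (u : HH A B) (h : Stb (ext M N u.1) (Tm A B 0)) :
    IsIso (quo (ext M N u.1) (Tm A B 0) h) (ext (quo M A hA) (quo N B hB) (resHom A B u).2) := by
  let e : (M.V × N.V) →ₗ[F] (M.V ⧸ A) × (N.V ⧸ B) := A.mkQ.prodMap B.mkQ
  have he : Function.Surjective e := by
    rintro ⟨a, b⟩
    obtain ⟨a, rfl⟩ := Submodule.Quotient.mk_surjective _ a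
    obtain ⟨b, rfl⟩ := Submodule.Quotient.mk_surjective _ b
    exact ⟨(a, b), rfl⟩
  have hk : Tm A B (0 : N.V →ₗ[F] M.V) = LinearMap.ker e := by
    ext ⟨m, n⟩
    simp [mem_Tm, e]
  refine ⟨(Submodule.quotEquivOfEq _ _ hk).trans (e.quotKerEquivOfSurjective he), fun v => ?_⟩
  obtain ⟨w, rfl⟩ := Submodule.Quotient.mk_surjective _ v
  rfl

theorem mackey2 {f g : Obj F → ℂ} (hf : Inv f) (hg : Inv g) (M N : Obj F)
    (A : Submodule F M.V) (B : Submodule F N.V) (hA : Stb M A) (hB : Stb N B) :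
    (Nat.card (HH A B) : ℂ)⁻¹ * ∑ u : N.V →ₗ[F] M.V,
      term (fun X Y => f X * g Y) (ext M N u) (Tm A B 0) =
    Dl f (sub M A hA) (sub N B hB) * Dl g (quo M A hA) (quo N B hB) := by
  have h1 : Dl f (sub M A hA) (sub N B hB) * Dl g (quo M A hA) (quo N B hB) =
    avg (fun u : HH A B => f (ext (sub M A hA) (sub N B hB) (resHom A B u).1) *
      g (ext (quo M A hA) (quo N B hB) (resHom A B u).2)) := by
    rw [avg_surj (resHom A B) (resHom_surj A B) (fun p => f (ext (sub M A hA) (sub N B hB) p.1) *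
      g (ext (quo M A hA) (quo N B hB) p.2))]
    exact (avg_prod _ _).symm
  rw [h1, avg]
  congr 1
  have := Fintype.ofFinite (HH A B)
  rw [finsum_eq_sum_of_fintype]
  rw [← Finset.sum_subset (Finset.subset_univ (Finset.univ.filter (fun u => u ∈ HH A B)))]
  · rw [Finset.sum_subtype (p := fun u => u ∈ HH A B) (F := this) _ (by simp)]
    refine Finset.sum_congr (by ext; simp) fun u _ => ?_
    have hs := (stb_iff M N A B u.1).2 ⟨⟨hA, hB⟩, u.2⟩
    rw [term_pos _ (ext M N u.1) _ hs, hf _ _ (ext_sub_iso M N A B hA hB u hs),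
      hg _ _ (ext_quo_iso M N A B hA hB u hs)]
  · intro u _ hu
    refine term_neg _ (ext M N u) _ ?_
    intro h
    exact hu (by simpa using ((stb_iff M N A B u).1 h).2)

theorem mackey {f g : Obj F → ℂ} (hf : Inv f) (hg : Inv g) (M N : Obj F) :
    Dl (mul f g) M N = mulP (fun A A' => mul (Dl f A) (Dl g A') N) M := by
  have h1 : Dl (mul f g) M N = ∑ A : Submodule F M.V, ∑ B : Submodule F N.V,
      avg (fun u => (Nat.card (HH A B) : ℂ)⁻¹ *
      ∑ φ : N.V →ₗ[F] M.V, term (fun X Y => f X * g Y) (ext M N u) (Tm A B φ)) := by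
    simp only [← avg_sum]
    refine avg_congr _ _ fun u => ?_
    exact key_sum _
  rw [h1]
  refine Finset.sum_congr rfl fun A _ => ?_
  simp only [mackey1 (hf.mul2 hg)]
  have hz : ∀ B : Submodule F N.V, ¬ (Stb M A ∧ Stb N B) → (Nat.card (HH A B) : ℂ)⁻¹ *
      ∑ u : N.V →ₗ[F] M.V, term (fun X Y => f X * g Y) (ext M N u) (Tm A B 0) = 0 := by
    intro B hB
    rw [Finset.sum_eq_zero, mul_zero]
    intro u _
    refine term_neg _ (ext M N u) _ ?_
    intro h
    exact hB ((stb_iff M N A B u).1 h).1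
  by_cases hA : Stb M A
  · rw [term, dif_pos hA]
    refine Finset.sum_congr rfl fun B _ => ?_
    by_cases hB : Stb N B
    · rw [mackey2 hf hg M N A B hA hB, term, dif_pos hB]
    · rw [hz B (fun t => hB t.2), term, dif_neg hB]
  · rw [term, dif_neg hA, Finset.sum_eq_zero]
    intro B _
    exact hz B (fun t => hA t.1)

end HCPaper
end

section
open Matrix BigOperators
namespace HCPaper
open scoped Classical
variable {F : Type} [Field F]

/-! ### Self-duality of objects -/

section selfdual
open Polynomial

/-- `M` carries a nondegenerate `F[X]`-balanced `F`-bilinear form. -/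
def HasForm (M : Type) [AddCommGroup M] [Module F[X] M] : Prop :=
  ∃ b : M → M → F, (∀ v v' w, b (v + v') w = b v w + b v' w) ∧
    (∀ v w w', b v (w + w') = b v w + b v w') ∧
    (∀ (r : F[X]) v w, b (r • v) w = b v (r • w)) ∧
    (∀ (c : F) v w, b ((C c : F[X]) • v) w = c * b v w) ∧
    (∀ v, (∀ w, b v w = 0) → v = 0)

theorem HasForm.congr {M N : Type} [AddCommGroup M] [Module F[X] M] [AddCommGroup N] [Module F[X] N]
    (e : M ≃ₗ[F[X]] N) (h : HasForm (F := F) N) : HasForm (F := F) M := by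
  obtain ⟨b, h1, h2, h3, h4, h5⟩ := h
  refine ⟨fun v w => b (e v) (e w), ?_, ?_, ?_, ?_, ?_⟩
  · intros; simp [h1]
  · intros; simp [h2]
  · intros; simp [h3]
  · intros; simp [h4]
  · intro v hv
    have := h5 (e v) (fun w => by simpa using hv (e.symm w))
    simpa using this

theorem exists_lambda (q : F[X]) (hq : q ≠ 0) : ∃ l : F[X] →ₗ[F] F,
    (∀ a, q ∣ a → l a = 0) ∧ ∀ a, (∀ c, l (a * c) = 0) → q ∣ a := by
  set q' := q * C (q.leadingCoeff⁻¹) with hq'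
  have hm : q'.Monic := monic_mul_leadingCoeff_inv hq
  have hd : ∀ a, q' ∣ a ↔ q ∣ a := by
    intro a
    have hu : IsUnit (C (q.leadingCoeff⁻¹)) := by
      rw [isUnit_C]; exact (inv_ne_zero (leadingCoeff_ne_zero.2 hq)).isUnit
    rw [hq', hu.mul_right_dvd]
  refine ⟨(lcoeff F (q'.natDegree - 1)) ∘ₗ modByMonicHom q', ?_, ?_⟩
  · intro a ha
    have : a %ₘ q' = 0 := (modByMonic_eq_zero_iff_dvd hm).2 ((hd a).2 ha)
    simp [modByMonicHom, this]
  · intro a ha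
    rw [← hd, ← modByMonic_eq_zero_iff_dvd hm]
    by_contra hr
    set r := a %ₘ q' with hrdef
    have hlt : r.degree < q'.degree := degree_modByMonic_lt a hm
    have hlt' : r.natDegree < q'.natDegree := natDegree_lt_natDegree hr hlt
    have h1 := ha (X ^ (q'.natDegree - 1 - r.natDegree))
    have h2 : (a * X ^ (q'.natDegree - 1 - r.natDegree)) %ₘ q' =
        r * X ^ (q'.natDegree - 1 - r.natDegree) := by
      rw [modByMonic_eq_of_dvd_sub hm (p₂ := r * X ^ (q'.natDegree - 1 - r.natDegree)),
        modByMonic_eq_self_iff hm]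
      · rw [degree_mul, degree_X_pow, degree_eq_natDegree hr, degree_eq_natDegree hm.ne_zero]
        norm_cast
        omega
      · rw [← sub_mul]
        apply Dvd.dvd.mul_right
        rw [← dvd_neg, neg_sub]
        exact dvd_modByMonic_sub a q'
    simp only [LinearMap.comp_apply, modByMonicHom, LinearMap.coe_mk, AddHom.coe_mk, h2,
      lcoeff_apply] at h1
    have h3 : q'.natDegree - 1 = r.natDegree + (q'.natDegree - 1 - r.natDegree) := by omega
    rw [h3, Nat.add_sub_cancel_left, coeff_mul_X_pow, coeff_natDegree] at h1
    exact hr (leadingCoeff_eq_zero.1 h1)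

theorem hasForm_cyclic (q : F[X]) (hq : q ≠ 0) :
    HasForm (F := F) (F[X] ⧸ Submodule.span F[X] {q}) := by
  obtain ⟨l, h1, h2⟩ := exists_lambda q hq
  set Q := Submodule.span F[X] {q}
  have hs := Submodule.mkQ_surjective Q
  let o := Function.surjInv hs
  have ho : ∀ v, Q.mkQ (o v) = v := Function.surjInv_eq hs
  have hmem : ∀ a, a ∈ Q ↔ q ∣ a := fun a => Ideal.mem_span_singleton
  have hl : ∀ a a', Q.mkQ a = Q.mkQ a' → ∀ c, l (a * c) = l (a' * c) := by
    intro a a' h c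
    rw [← sub_eq_zero, ← map_sub, Submodule.mkQ_apply, Submodule.Quotient.mk_eq_zero, hmem] at h
    rw [← sub_eq_zero, ← map_sub, ← sub_mul]
    exact h1 _ (h.mul_right c)
  have hr : ∀ a a', Q.mkQ a = Q.mkQ a' → ∀ c, l (c * a) = l (c * a') := by
    intro a a' h c
    rw [mul_comm c, mul_comm c]; exact hl a a' h c
  refine ⟨fun v w => l (o v * o w), ?_, ?_, ?_, ?_, ?_⟩
  · intro v v' w
    beta_reduce
    rw [hl (o (v + v')) (o v + o v') (by rw [map_add, ho, ho, ho]), add_mul, map_add]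
  · intro v w w'
    beta_reduce
    rw [hr (o (w + w')) (o w + o w') (by rw [map_add, ho, ho, ho]), mul_add, map_add]
  · intro r v w
    beta_reduce
    rw [hl (o (r • v)) (r • o v) (by rw [map_smul, ho, ho]),
      hr (o (r • w)) (r • o w) (by rw [map_smul, ho, ho])]
    simp only [smul_eq_mul]; congr 1; ring
  · intro c v w
    beta_reduce
    rw [hl (o ((C c : F[X]) • v)) ((C c : F[X]) • o v) (by rw [map_smul, ho, ho])]
    rw [smul_eq_mul, mul_assoc, ← smul_eq_C_mul, map_smul, smul_eq_mul]
  · intro v hv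
    have : q ∣ o v := by
      apply h2
      intro c
      rw [hr c (o (Q.mkQ c)) (by rw [ho])]
      exact hv _
    rw [← ho v, Submodule.mkQ_apply, Submodule.Quotient.mk_eq_zero, hmem]
    exact this

theorem hasForm_directSum {ι : Type} [Fintype ι] (M : ι → Type) [∀ i, AddCommGroup (M i)]
    [∀ i, Module F[X] (M i)] (h : ∀ i, HasForm (F := F) (M i)) :
    HasForm (F := F) (DirectSum ι M) := by
  choose b h1 h2 h3 h4 h5 using h
  refine ⟨fun v w => ∑ i, b i (v i) (w i), ?_, ?_, ?_, ?_, ?_⟩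
  · intros; simp [h1, Finset.sum_add_distrib]
  · intros; simp [h2, Finset.sum_add_distrib]
  · intros; simp [DirectSum.smul_apply, h3]
  · intros; simp [DirectSum.smul_apply, h4, Finset.mul_sum]
  · intro v hv
    refine DFinsupp.ext fun i => ?_
    refine h5 i (v i) fun w => ?_
    have := hv (DirectSum.of M i w)
    have hz : ∀ j (a : M j), b j a 0 = 0 := by
      intro j a
      have := h2 j a 0 0
      simpa using this
    beta_reduce at this
    rw [Finset.sum_eq_single i] at this
    · simpa using this
    · intro j _ hj
      rw [DirectSum.of_eq_of_ne _ _ _ hj, hz]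
    · simp

theorem exists_form (X : Obj F) : ∃ b : X.V →ₗ[F] X.V →ₗ[F] F,
    (∀ v w, b (X.x v) w = b v (X.x w)) ∧ Function.Injective b := by
  have ht : Module.IsTorsion F[X] (Module.AEval' X.x) :=
    Module.AEval.isTorsion_of_finiteDimensional F X.V X.x
  obtain ⟨ι, _, p, hp, e, ⟨E⟩⟩ := Module.equiv_directSum_of_isTorsion ht
  have hF : HasForm (F := F) (Module.AEval' X.x) :=
    HasForm.congr E (hasForm_directSum _ fun i => hasForm_cyclic _ (pow_ne_zero _ (hp i).ne_zero))
  obtain ⟨b, h1, h2, h3, h4, h5⟩ := hF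
  let o := Module.AEval'.of X.x
  have hC : ∀ (c : F) (v : X.V), o (c • v) = (C c : F[X]) • o v := by
    intro c v
    rw [map_smul]
    exact (Module.AEval.C_smul X.x c (o v)).symm
  have hX : ∀ (v : X.V), o (X.x v) = (Polynomial.X : F[X]) • o v := by
    intro v; exact (Module.AEval'.X_smul_of X.x v).symm
  refine ⟨LinearMap.mk₂ F (fun v w => b (o v) (o w)) ?_ ?_ ?_ ?_, ?_, ?_⟩
  · intros; simp [h1]
  · intro c v w
    rw [hC, h4]; rfl
  · intros; simp [h2]
  · intro c v w
    rw [hC, ← h3, h4]; rfl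
  · intro v w
    simp only [LinearMap.mk₂_apply]
    rw [hX, hX, h3]
  · rw [injective_iff_map_eq_zero]
    intro v hv
    have : o v = 0 := h5 _ fun w => by
      have := LinearMap.congr_fun hv (o.symm w)
      simpa using this
    simpa using this

end selfdual

variable [Finite F]

instance finDual {V : Type} [AddCommGroup V] [Module F V] [Finite V] : Finite (Module.Dual F V) :=
  inferInstanceAs (Finite (V →ₗ[F] F))

def dualO (X : Obj F) : Obj F := ⟨Module.Dual F X.V, X.x.dualMap⟩

theorem self_dual (X : Obj F) : IsIso X (dualO X) := by
  obtain ⟨b, hb, hi⟩ := exists_form X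
  have e : ∃ e : X.V ≃ₗ[F] Module.Dual F X.V, ∀ v, e v = b v :=
    ⟨LinearEquiv.ofInjectiveOfFinrankEq b hi Subspace.dual_finrank_eq.symm, fun v => rfl⟩
  obtain ⟨e, he⟩ := e
  refine ⟨e, fun v => ?_⟩
  have h1 : b (X.x v) = X.x.dualMap (b v) := LinearMap.ext fun w => hb v w
  change e (X.x v) = X.x.dualMap (e v)
  rw [he, he, h1]

theorem mul_comm' {f g : Obj F → ℂ} (hf : Inv f) (hg : Inv g) (X : Obj F) :
    mul f g X = mul g f X := by
  rw [mul_inv' hg hf _ _ (self_dual X)]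
  refine Fintype.sum_equiv
    ((Subspace.orderIsoFiniteDimensional (K := F) (V := X.V)).toEquiv.trans OrderDual.ofDual)
    _ _ fun W => ?_
  change _ = term _ (dualO X) W.dualAnnihilator
  by_cases h : Stb X W
  · have h' : Stb (dualO X) W.dualAnnihilator := by
      intro φ hφ
      refine (Submodule.mem_dualAnnihilator _).2 fun w hw => ?_
      exact (Submodule.mem_dualAnnihilator _).1 hφ _ (h _ hw)
    rw [term_pos _ _ _ h, term_pos _ _ _ h', mul_comm]
    congr 1
    · apply hg
      refine (self_dual _).trans ⟨W.dualQuotEquivDualAnnihilator, fun φ => rfl⟩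
    · apply hf
      refine (self_dual _).trans (IsIso.symm ⟨Subspace.quotAnnihilatorEquiv W, fun v => ?_⟩)
      obtain ⟨φ, rfl⟩ := Submodule.Quotient.mk_surjective _ v
      rfl
  · have h' : ¬ Stb (dualO X) W.dualAnnihilator := by
      intro h'
      apply h
      intro v hv
      rw [← Subspace.dualAnnihilator_dualCoannihilator_eq (W := W), Submodule.mem_dualCoannihilator]
      intro φ hφ
      exact (Submodule.mem_dualAnnihilator _).1 (h' φ hφ) v hv
    rw [term_neg _ _ _ h, term_neg _ _ _ h']

end HCPaper
end

section
open Matrix BigOperators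
namespace HCPaper
open scoped Classical
variable {F : Type} [Field F]

/-! ### The antipode -/

theorem Inv2.snd {P : Obj F → Obj F → ℂ} (hP : Inv2 P) (A : Obj F) : Inv (P A) :=
  fun _ _ h => hP _ _ _ _ (IsIso.refl A) h

theorem Inv2.fst {P : Obj F → Obj F → ℂ} (hP : Inv2 P) {A A' : Obj F} (h : IsIso A A') :
    P A = P A' :=
  funext fun B => hP _ _ _ _ h (IsIso.refl B)

theorem IsIso.dim {X Y : Obj F} (h : IsIso X Y) :
    Module.finrank F X.V = Module.finrank F Y.V := by
  obtain ⟨e, _⟩ := h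
  exact e.finrank_eq

theorem term_congr {P Q : Obj F → Obj F → ℂ} (X : Obj F) (W : Submodule F X.V)
    (h : ∀ h : Stb X W, P (sub X W h) (quo X W h) = Q (sub X W h) (quo X W h)) :
    term P X W = term Q X W := by
  unfold term
  split_ifs with h'
  · exact h h'
  · rfl

theorem mulP_congr {P Q : Obj F → Obj F → ℂ} (X : Obj F)
    (h : ∀ W, ∀ h : Stb X W, P (sub X W h) (quo X W h) = Q (sub X W h) (quo X W h)) :
    mulP P X = mulP Q X :=
  Finset.sum_congr rfl fun W _ => term_congr X W (h W)

theorem term_sum {ι : Type} (s : Finset ι) (P : ι → Obj F → Obj F → ℂ) (X : Obj F)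
    (W : Submodule F X.V) :
    term (fun A B => ∑ i ∈ s, P i A B) X W = ∑ i ∈ s, term (P i) X W := by
  by_cases h : Stb X W
  · rw [term_pos _ _ _ h]
    exact Finset.sum_congr rfl fun i _ => (term_pos _ _ _ h).symm
  · rw [term_neg _ _ _ h]
    exact (Finset.sum_eq_zero fun i _ => (term_neg _ _ _ h)).symm

theorem mulP_sum {ι : Type} (s : Finset ι) (P : ι → Obj F → Obj F → ℂ) (X : Obj F) :
    mulP (fun A B => ∑ i ∈ s, P i A B) X = ∑ i ∈ s, mulP (P i) X := by
  unfold mulP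
  rw [Finset.sum_comm]
  exact Finset.sum_congr rfl fun W _ => term_sum s P X W

theorem mulP_const (c : ℂ) (P : Obj F → Obj F → ℂ) (X : Obj F) :
    mulP (fun A B => c * P A B) X = c * mulP P X := by
  unfold mulP
  rw [Finset.mul_sum]
  refine Finset.sum_congr rfl fun W _ => ?_
  unfold term
  split_ifs <;> simp

def zeroO : Obj F := ⟨PUnit, 0⟩

theorem iso_zero {X : Obj F} (h : Module.finrank F X.V = 0) : IsIso X zeroO := by
  have : Subsingleton X.V := Module.finrank_zero_iff.1 h
  refine ⟨⟨0, fun _ => 0, fun _ => Subsingleton.elim _ _, fun _ => rfl⟩, fun v => rfl⟩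

theorem stb_bot (X : Obj F) : Stb X ⊥ := by
  intro v hv
  rw [Submodule.mem_bot] at hv ⊢
  rw [hv, map_zero]

theorem term_bot {P : Obj F → Obj F → ℂ} (hP : Inv2 P) (X : Obj F) :
    term P X ⊥ = P zeroO X := by
  rw [term_pos _ _ _ (stb_bot X)]
  apply hP
  · apply iso_zero
    exact finrank_bot F X.V
  · refine ⟨Submodule.quotEquivOfEqBot ⊥ rfl, fun v => ?_⟩
    obtain ⟨v, rfl⟩ := Submodule.Quotient.mk_surjective _ v
    rfl

theorem mulP_eq_bot {P : Obj F → Obj F → ℂ} (hP : Inv2 P) (X : Obj F)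
    (h : ∀ W, W ≠ ⊥ → ∀ h : Stb X W, P (sub X W h) (quo X W h) = 0) :
    mulP P X = P zeroO X := by
  rw [← term_bot hP]
  refine Finset.sum_eq_single ⊥ (fun W _ hW => ?_) (by simp)
  by_cases h' : Stb X W
  · rw [term_pos _ _ _ h', h W hW h']
  · exact term_neg _ _ _ h'

theorem mulP_zero {P : Obj F → Obj F → ℂ} (hP : Inv2 P) : mulP P zeroO = P zeroO zeroO := by
  refine mulP_eq_bot hP _ fun W hW => ?_
  exfalso; apply hW
  refine (Submodule.eq_bot_iff _).2 fun x _ => ?_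
  rfl

theorem Dl_zero {f : Obj F → ℂ} (hf : Inv f) : Dl f zeroO = f := by
  funext N
  unfold Dl
  have : Unique (N.V →ₗ[F] (zeroO : Obj F).V) :=
    ⟨⟨0⟩, fun a => LinearMap.ext fun v => rfl⟩
  have h : ∀ u, f (ext zeroO N u) = f N := by
    intro u
    apply hf
    refine ⟨⟨LinearMap.snd _ _ _, fun n => (0, n), fun p => rfl, fun n => rfl⟩, fun p => rfl⟩
  simp only [h]
  rw [avg_eq]
  simp

theorem dim_sub (X : Obj F) (W : Submodule F X.V) (h : Stb X W) :
    Module.finrank F (sub X W h).V = Module.finrank F W := rfl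

theorem dim_quo (X : Obj F) (W : Submodule F X.V) (h : Stb X W) :
    Module.finrank F (sub X W h).V + Module.finrank F (quo X W h).V = Module.finrank F X.V := by
  rw [add_comm]; exact Submodule.finrank_quotient_add_finrank W

noncomputable def Rh : List ℕ → (Obj F → ℂ) → Obj F → ℂ
  | [], f => f
  | (k :: L), f => mulP (fun A B => if Module.finrank F A.V = k then Rh L (Dl f A) B else 0)

theorem Rh_inv (L : List ℕ) : ∀ {f : Obj F → ℂ}, Inv f → Inv (Rh L f) := by
  induction L with
  | nil => intro f hf; exact hf
  | cons k L ih =>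
    intro f hf
    apply mulP_inv
    intro A A' B B' h h'
    simp only [h.dim, (Dl_inv hf).fst h, ih ((Dl_inv hf).snd A') _ _ h']

theorem Rh_sum {ι : Type} (s : Finset ι) (L : List ℕ) : ∀ (f : ι → Obj F → ℂ) (X : Obj F),
    Rh L (fun X => ∑ i ∈ s, f i X) X = ∑ i ∈ s, Rh L (f i) X := by
  induction L with
  | nil => intro f X; rfl
  | cons k L ih =>
    intro f X
    unfold Rh
    rw [← mulP_sum]
    congr 1
    funext A B
    split_ifs with h
    · rw [← ih]
      congr 1
      funext N
      exact Dl_sum _ _ _ _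
    · simp

theorem Rh_vanish (L : List ℕ) : ∀ (d : ℕ) (f : Obj F → ℂ)
    (_ : ∀ X : Obj F, Module.finrank F X.V = d → f X = 0) (X : Obj F)
    (_ : Module.finrank F X.V = d), Rh L f X = 0 := by
  induction L with
  | nil => intro d f hf X hX; exact hf X hX
  | cons k L ih =>
    intro d f hf X hX
    unfold Rh
    refine Finset.sum_eq_zero fun W _ => ?_
    by_cases h : Stb X W
    · rw [term_pos _ _ _ h]
      split_ifs with h'
      · refine ih (Module.finrank F (quo X W h).V) _ ?_ _ rfl
        intro B hB
        unfold Dl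
        rw [avg_congr _ (fun _ => 0)]
        · rw [avg_eq]; simp
        · intro u
          apply hf
          refine (Module.finrank_prod).trans ?_
          rw [hB, dim_quo, hX]
      · rfl
    · exact term_neg _ _ _ h

/-- The antipode. -/
noncomputable def S (f : Obj F → ℂ) (X : Obj F) : ℂ :=
  ∑ c : Composition (Module.finrank F X.V), (-1) ^ c.length * Rh c.blocks f X

theorem S_eq (f : Obj F → ℂ) (X : Obj F) (n : ℕ) (h : Module.finrank F X.V = n) :
    S f X = ∑ c : Composition n, (-1) ^ c.length * Rh c.blocks f X := by
  subst h; rfl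

theorem S_inv {f : Obj F → ℂ} (hf : Inv f) : Inv (S f) := by
  intro X Y h
  rw [S_eq f X _ h.dim, S]
  exact Finset.sum_congr rfl fun c _ => by rw [Rh_inv c.blocks hf _ _ h]

theorem S_sum {ι : Type} (s : Finset ι) (f : ι → Obj F → ℂ) (X : Obj F) :
    S (fun X => ∑ i ∈ s, f i X) X = ∑ i ∈ s, S (f i) X := by
  unfold S
  rw [Finset.sum_comm]
  refine Finset.sum_congr rfl fun c _ => ?_
  rw [Rh_sum, Finset.mul_sum]

theorem S_vanish (d : ℕ) (f : Obj F → ℂ)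
    (h : ∀ X : Obj F, Module.finrank F X.V = d → f X = 0) (X : Obj F)
    (hX : Module.finrank F X.V = d) : S f X = 0 :=
  Finset.sum_eq_zero fun c _ => by rw [Rh_vanish _ d f h X hX, mul_zero]

theorem S_zero (f : Obj F → ℂ) (X : Obj F) (h : Module.finrank F X.V = 0) : S f X = f X := by
  rw [S_eq f X 0 h]
  rw [Fintype.sum_eq_single (default : Composition 0)]
  · have : (default : Composition 0).blocks = [] := rfl
    simp [Composition.length, this, Rh]
  · intro c hc
    have : Subsingleton (Composition 0) :=
      Fintype.card_le_one_iff_subsingleton.1 (by rw [composition_card]; norm_num)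
    exact absurd (Subsingleton.elim _ _) hc

theorem comp_rec (n : ℕ) (hn : 0 < n) (φ : List ℕ → ℂ) :
    ∑ c : Composition n, φ c.blocks =
      ∑ k : Fin n, ∑ c : Composition (n - (k + 1)), φ ((k + 1 : ℕ) :: c.blocks) := by
  rw [Finset.sum_sigma', Finset.univ_sigma_univ]
  symm
  refine Fintype.sum_bijective (fun p : (k : Fin n) × Composition (n - (k + 1)) =>
    (⟨(p.1 + 1 : ℕ) :: p.2.blocks, ?_, ?_⟩ : Composition n)) ⟨?_, ?_⟩ _ _ ?_
  · intro i hi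
    rcases List.mem_cons.1 hi with rfl | h
    · omega
    · exact p.2.blocks_pos h
  · rw [List.sum_cons, p.2.blocks_sum]; omega
  · rintro ⟨k, c⟩ ⟨k', c'⟩ h
    simp only [Composition.mk.injEq, List.cons.injEq] at h
    obtain ⟨h1, h2⟩ := h
    have : k = k' := Fin.ext (by omega)
    subst this
    have : c = c' := Composition.ext h2
    subst this
    rfl
  · rintro ⟨L, h1, h2⟩
    cases L with
    | nil => simp at h2; omega
    | cons k L =>
      have hk : 0 < k := h1 (by simp)
      have hs : k + L.sum = n := by simpa using h2
      refine ⟨⟨⟨k - 1, by omega⟩, ⟨L, fun hi => h1 (by simp [hi]), by simp; omega⟩⟩, ?_⟩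
      simp only [Composition.mk.injEq, List.cons.injEq, and_true]
      omega
  · intro p; rfl

theorem SDl_inv {f : Obj F → ℂ} (hf : Inv f) : Inv2 (fun A B => S (Dl f A) B) := by
  intro A A' B B' h h'
  simp only [(Dl_inv hf).fst h, S_inv ((Dl_inv hf).snd A') _ _ h']

theorem S_rec {f : Obj F → ℂ} (X : Obj F) (hX : 0 < Module.finrank F X.V) :
    S f X = - ∑ W ∈ Finset.univ.erase (⊥ : Submodule F X.V),
      term (fun A B => S (Dl f A) B) X W := by
  rw [S_eq f X _ rfl]
  simp only [Composition.length]
  rw [comp_rec _ hX (fun L => (-1) ^ L.length * Rh L f X)]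
  simp only [Rh, mulP, Finset.mul_sum]
  simp_rw [Finset.sum_comm (s := (Finset.univ : Finset (Composition _)))]
  rw [Finset.sum_comm, ← Finset.add_sum_erase _ _ (Finset.mem_univ (⊥ : Submodule F X.V)),
    ← Finset.sum_neg_distrib]
  rw [Finset.sum_eq_zero, zero_add]
  · refine Finset.sum_congr rfl fun W hW => ?_
    have hW' : W ≠ ⊥ := (Finset.mem_erase.1 hW).1
    have hpos : 0 < Module.finrank F W := by
      rw [Nat.pos_iff_ne_zero]; intro h0
      exact hW' (Submodule.finrank_eq_zero.1 h0)
    by_cases h : Stb X W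
    · have hd := dim_quo X W h
      have hs := dim_sub X W h
      simp only [term_pos _ _ _ h]
      have hlt : Module.finrank F W - 1 < Module.finrank F X.V := by omega
      rw [Finset.sum_eq_single (⟨Module.finrank F W - 1, hlt⟩ : Fin (Module.finrank F X.V))]
      · have hk : Module.finrank F (sub X W h).V = Module.finrank F W - 1 + 1 := by omega
        simp only [hk, if_true]
        rw [S_eq _ _ (Module.finrank F X.V - (Module.finrank F W - 1 + 1)) (by omega),
          ← Finset.sum_neg_distrib]
        refine Finset.sum_congr rfl fun c _ => ?_
        simp only [List.length_cons, Composition.length]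
        ring
      · intro k _ hk
        refine Finset.sum_eq_zero fun c _ => ?_
        rw [if_neg, mul_zero]
        intro h'
        apply hk
        apply Fin.ext
        simp only
        omega
      · simp
    · simp [term_neg _ _ _ h]
  · intro k _
    refine Finset.sum_eq_zero fun c _ => ?_
    rw [term_pos _ _ _ (stb_bot X), if_neg, mul_zero]
    rw [dim_sub, finrank_bot]
    omega

theorem S_conv {f : Obj F → ℂ} (hf : Inv f) (X : Obj F) :
    mulP (fun A B => S (Dl f A) B) X = if Module.finrank F X.V = 0 then f zeroO else 0 := by
  split_ifs with h
  · rw [mulP_inv (SDl_inv hf) _ _ (iso_zero h), mulP_zero (SDl_inv hf), Dl_zero hf, S_zero]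
    exact (iso_zero h).dim.symm.trans h
  · unfold mulP
    rw [← Finset.add_sum_erase _ _ (Finset.mem_univ (⊥ : Submodule F X.V)), term_bot (SDl_inv hf)]
    beta_reduce
    rw [Dl_zero hf, S_rec X (Nat.pos_of_ne_zero h), neg_add_cancel]

variable [Finite F]

theorem T_zero {f g : Obj F → ℂ} (hf : Inv f) (hg : Inv g) (X : Obj F)
    (hX : Module.finrank F X.V ≠ 0) :
    mulP (fun M C => mulP (fun A A' => mul (S (Dl f A)) (S (Dl g A')) C) M) X = 0 := by
  have hSf := fun A => S_inv ((Dl_inv hf).snd A)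
  have hSg := fun A => S_inv ((Dl_inv hg).snd A)
  have h1 : (fun M C => mulP (fun A A' => mul (S (Dl f A)) (S (Dl g A')) C) M) =
      (fun M C => mulP (fun A A' => mul (S (Dl g A')) (S (Dl f A)) C) M) := by
    funext M C
    congr 1
    funext A A'
    exact mul_comm' (hSf _) (hSg _) _
  rw [h1, assoc (K := fun A B C => mul (S (Dl g B)) (S (Dl f A)) C)]
  · have h2 : (fun A Y => mulP (fun B C => mul (S (Dl g B)) (S (Dl f A)) C) Y) =
        (fun A Y => g zeroO * S (Dl f A) Y) := by
      funext A Y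
      unfold mul
      rw [← assoc (K := fun B C1 C2 => S (Dl g B) C1 * S (Dl f A) C2)]
      · have h3 : (fun N C => mulP (fun B C1 => S (Dl g B) C1 * S (Dl f A) C) N) =
          (fun N C => S (Dl f A) C * if Module.finrank F N.V = 0 then g zeroO else 0) := by
          funext N C
          rw [← S_conv hg, ← mulP_const]
          simp only [mul_comm]
        rw [h3, mulP_eq_bot]
        · rw [if_pos, mul_comm]
          exact Module.finrank_zero_of_subsingleton (M := PUnit)
        · intro B B' C C' h h'
          simp only [h.dim, hSf A _ _ h']
        · intro W hW h
          rw [if_neg, mul_zero]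
          intro h0
          exact hW (Submodule.finrank_eq_zero.1 h0)
      · intro B B' C C' D D' h h' h''
        simp only [hSf A _ _ h'', (Dl_inv hg).fst h, hSg _ _ _ h']
    rw [h2, mulP_const, S_conv hf, if_neg hX, mul_zero]
  · intro A A' B B' C C' h h' h''
    simp only [(Dl_inv hf).fst h, (Dl_inv hg).fst h']
    exact mul_inv' (hSg _) (hSf _) _ _ h''

theorem S_mul (n : ℕ) : ∀ {f g : Obj F → ℂ} (_ : Inv f) (_ : Inv g) (X : Obj F)
    (_ : Module.finrank F X.V = n), S (mul f g) X = mul (S f) (S g) X := by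
  induction n using Nat.strong_induction_on with
  | _ n ih =>
  intro f g hf hg X hX
  have hI := mul_inv' (S_inv hf) (S_inv hg)
  by_cases h0 : Module.finrank F X.V = 0
  · have hz : Module.finrank F (zeroO : Obj F).V = 0 := (iso_zero h0).dim.symm.trans h0
    rw [S_zero _ _ h0, mul_inv' hf hg _ _ (iso_zero h0), hI _ _ (iso_zero h0)]
    unfold mul
    rw [mulP_zero (hf.mul2 hg), mulP_zero ((S_inv hf).mul2 (S_inv hg)), S_zero _ _ hz,
      S_zero _ _ hz]
  · have hT := T_zero hf hg X h0
    have hSf := fun A => S_inv ((Dl_inv hf).snd A)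
    have hSg := fun A => S_inv ((Dl_inv hg).snd A)
    have hi1 : ∀ C, Inv2 (fun A A' => mul (S (Dl f A)) (S (Dl g A')) C) := by
      intro C A A' B B' h h'
      simp only [(Dl_inv hf).fst h, (Dl_inv hg).fst h']
    have hi2 : Inv2 (fun M C => mulP (fun A A' => mul (S (Dl f A)) (S (Dl g A')) C) M) := by
      intro M M' C C' h h'
      beta_reduce
      rw [mulP_inv (hi1 C) _ _ h]
      congr 1
      funext A A'
      exact mul_inv' (hSf _) (hSg _) _ _ h'
    unfold mulP at hT
    rw [← Finset.add_sum_erase _ _ (Finset.mem_univ (⊥ : Submodule F X.V))] at hT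
    have hb := term_bot hi2 X
    unfold mulP at hb
    rw [hb] at hT
    have hb2 := mulP_zero (hi1 X)
    unfold mulP at hb2
    rw [hb2, Dl_zero hf, Dl_zero hg] at hT
    rw [S_rec X (Nat.pos_of_ne_zero h0), eq_comm, eq_neg_iff_add_eq_zero, ← hT]
    congr 1
    refine Finset.sum_congr rfl fun W hW => ?_
    have hW' : W ≠ ⊥ := (Finset.mem_erase.1 hW).1
    have hpos : 0 < Module.finrank F W := by
      rw [Nat.pos_iff_ne_zero]; intro h0
      exact hW' (Submodule.finrank_eq_zero.1 h0)
    refine term_congr X W fun h => ?_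
    have hd := dim_quo X W h
    have hs := dim_sub X W h
    have hm : Dl (mul f g) (sub X W h) = fun N => ∑ W', term
        (fun A A' => mul (Dl f A) (Dl g A') N) (sub X W h) W' := by
      funext N
      exact mackey hf hg _ _
    rw [hm, S_sum]
    refine Finset.sum_congr rfl fun W' _ => ?_
    by_cases h' : Stb (sub X W h) W'
    · simp only [term_pos _ _ _ h']
      exact ih (Module.finrank F (quo X W h).V) (by omega) ((Dl_inv hf).snd _)
        ((Dl_inv hg).snd _) _ rfl
    · simp only [term_neg _ _ _ h']
      exact S_vanish _ _ (fun _ _ => rfl) _ rfl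

end HCPaper
end

section
open Matrix BigOperators
namespace HCPaper
open scoped Classical
variable {F : Type} [Field F] [Finite F]

/-! ### Matrices as objects -/

def obj {n : ℕ} (z : gl F n) : Obj F := ⟨Fin n → F, z.mulVecLin⟩

theorem obj_x {n : ℕ} (z : gl F n) (v : Fin n → F) : (obj z).x v = z *ᵥ v := rfl

theorem dim_obj {n : ℕ} (z : gl F n) : Module.finrank F (obj z).V = n :=
  Module.finrank_fin_fun F

/-- the linear automorphism given by an invertible matrix -/
def gE {n : ℕ} (g : Matrix.GeneralLinearGroup (Fin n) F) : (Fin n → F) ≃ₗ[F] (Fin n → F) :=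
  LinearEquiv.ofLinear (g : Matrix (Fin n) (Fin n) F).mulVecLin
    ((g⁻¹ : Matrix.GeneralLinearGroup (Fin n) F) : Matrix (Fin n) (Fin n) F).mulVecLin
    (by rw [← Matrix.mulVecLin_mul, ← Units.val_mul, mul_inv_cancel]; simp)
    (by rw [← Matrix.mulVecLin_mul, ← Units.val_mul, inv_mul_cancel]; simp)

theorem gE_apply {n : ℕ} (g : Matrix.GeneralLinearGroup (Fin n) F) (v : Fin n → F) :
    gE g v = (g : Matrix (Fin n) (Fin n) F) *ᵥ v := rfl

theorem gE_mul {n : ℕ} (g g' : Matrix.GeneralLinearGroup (Fin n) F) (v : Fin n → F) :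
    gE (g * g') v = gE g (gE g' v) := by
  simp [gE_apply]

theorem gE_conj {n : ℕ} (g : Matrix.GeneralLinearGroup (Fin n) F) (z : gl F n) (v : Fin n → F) :
    gE g (z *ᵥ v) = conjM g z *ᵥ (gE g v) := by
  simp only [gE_apply, conjM, Matrix.mulVec_mulVec]
  rw [Matrix.mul_assoc (_ * _), ← Units.val_mul, inv_mul_cancel]; simp

theorem gE_surj {n : ℕ} (e : (Fin n → F) ≃ₗ[F] (Fin n → F)) :
    ∃ g : Matrix.GeneralLinearGroup (Fin n) F, ∀ v, gE g v = e v := by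
  refine ⟨⟨LinearMap.toMatrix' (e : (Fin n → F) →ₗ[F] (Fin n → F)),
    LinearMap.toMatrix' (e.symm : (Fin n → F) →ₗ[F] (Fin n → F)), ?_, ?_⟩, ?_⟩
  · rw [← LinearMap.toMatrix'_comp]; simp
  · rw [← LinearMap.toMatrix'_comp]; simp
  · intro v
    rw [gE_apply]
    exact LinearMap.toMatrix'_mulVec _ _

theorem iso_conj {n : ℕ} (z z' : gl F n) (h : IsIso (obj z) (obj z')) :
    ∃ g, z' = conjM g z := by
  obtain ⟨e, he⟩ := h
  obtain ⟨g, hg⟩ := gE_surj e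
  refine ⟨g, ?_⟩
  apply Matrix.mulVec_injective
  funext v
  obtain ⟨w, rfl⟩ := (gE g).surjective v
  rw [← gE_conj, hg, hg]
  exact (he w).symm

theorem castM_rfl {n : ℕ} (h : n = n) (x : gl F n) : castM h x = x := by
  ext i j; rfl

theorem obj_cast {m n : ℕ} (h : m = n) (x : gl F m) : IsIso (obj (castM h x)) (obj x) := by
  subst h
  rw [castM_rfl]
  exact IsIso.refl _

theorem exists_lift {n : ℕ} (f : gl F n → ℂ) (hf : Invariant n f) :
    ∃ f' : Obj F → ℂ, Inv f' ∧ (∀ z, f' (obj z) = f z) ∧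
      ∀ X : Obj F, Module.finrank F X.V ≠ n → f' X = 0 := by
  have key : ∀ z z' : gl F n, IsIso (obj z) (obj z') → f z = f z' := by
    intro z z' h
    obtain ⟨g, rfl⟩ := iso_conj z z' h
    exact (hf g z).symm
  let f' : Obj F → ℂ := fun X => if h : ∃ z : gl F n, IsIso X (obj z) then f h.choose else 0
  have h1 : ∀ X z, IsIso X (obj z) → f' X = f z := by
    intro X z h
    have h' : ∃ z : gl F n, IsIso X (obj z) := ⟨z, h⟩
    change (dite _ _ _) = _
    rw [dif_pos h']
    exact key _ _ (h'.choose_spec.symm.trans h)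
  have h2 : ∀ X, (¬ ∃ z : gl F n, IsIso X (obj z)) → f' X = 0 := by
    intro X h
    change (dite _ _ _) = _
    rw [dif_neg h]
  refine ⟨f', ?_, fun z => h1 _ _ (IsIso.refl _), ?_⟩
  · intro X Y h
    by_cases hX : ∃ z : gl F n, IsIso X (obj z)
    · obtain ⟨z, hz⟩ := hX
      rw [h1 X z hz, h1 Y z (h.symm.trans hz)]
    · rw [h2 X hX, h2 Y]
      rintro ⟨z, hz⟩
      exact hX ⟨z, h.trans hz⟩
  · intro X hX
    apply h2
    rintro ⟨z, hz⟩
    exact hX (hz.dim.trans (dim_obj z))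

theorem Dl_zero' {f : Obj F → ℂ} (hf : Inv f) (M : Obj F) : Dl f M zeroO = f M := by
  unfold Dl
  have : Unique ((zeroO : Obj F).V →ₗ[F] M.V) :=
    ⟨⟨0⟩, fun a => LinearMap.ext fun v => (map_zero a)⟩
  have h : ∀ u, f (ext M zeroO u) = f M := by
    intro u
    apply hf
    refine ⟨⟨LinearMap.fst _ _ _, fun n => (n, 0), fun p => rfl, fun n => rfl⟩, fun p => ?_⟩
    change M.x p.1 + u p.2 = M.x p.1
    have : u p.2 = 0 := map_zero u
    rw [this, add_zero]
  simp only [h]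
  rw [avg_eq]
  simp

theorem stb_top (X : Obj F) : Stb X ⊤ := fun _ _ => trivial

theorem term_top {P : Obj F → Obj F → ℂ} (hP : Inv2 P) (X : Obj F) :
    term P X ⊤ = P X zeroO := by
  rw [term_pos _ _ _ (stb_top X)]
  apply hP
  · exact ⟨Submodule.topEquiv, fun v => rfl⟩
  · apply iso_zero
    have h1 := dim_quo X ⊤ (stb_top X)
    have h2 := dim_sub X ⊤ (stb_top X)
    rw [finrank_top] at h2
    omega

theorem mulP_eq_top {P : Obj F → Obj F → ℂ} (hP : Inv2 P) (X : Obj F)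
    (h : ∀ W, W ≠ ⊤ → ∀ h : Stb X W, P (sub X W h) (quo X W h) = 0) :
    mulP P X = P X zeroO := by
  rw [← term_top hP]
  refine Finset.sum_eq_single ⊤ (fun W _ hW => ?_) (by simp)
  by_cases h' : Stb X W
  · rw [term_pos _ _ _ h', h W hW h']
  · exact term_neg _ _ _ h'

/-- splitting coordinates -/
def spl (k l : ℕ) : (Fin (k + l) → F) ≃ₗ[F] (Fin k → F) × (Fin l → F) :=
  (LinearEquiv.funCongrLeft F F finSumFinEquiv).trans
    (LinearEquiv.sumArrowLequivProdArrow (Fin k) (Fin l) F F)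

theorem spl_fst (k l : ℕ) (v : Fin (k + l) → F) :
    (spl k l v).1 = (v ∘ finSumFinEquiv) ∘ Sum.inl := rfl
theorem spl_snd (k l : ℕ) (v : Fin (k + l) → F) :
    (spl k l v).2 = (v ∘ finSumFinEquiv) ∘ Sum.inr := rfl

theorem mulVec_comp {k l : ℕ} (m : gl F (k + l)) (v : Fin (k + l) → F) :
    (m *ᵥ v) ∘ finSumFinEquiv = blk k l m *ᵥ (v ∘ finSumFinEquiv) := by
  funext i
  simp only [Function.comp, Matrix.mulVec, dotProduct, blk]
  refine (Fintype.sum_equiv finSumFinEquiv _ _ fun j => ?_).symm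
  simp

theorem blk_but {k l : ℕ} (x : gl F k) (u : Matrix (Fin k) (Fin l) F) (y : gl F l) :
    blk k l (but k l x u y) = Matrix.fromBlocks x u 0 y := by
  simp [blk, but]

theorem spl_but {k l : ℕ} (x : gl F k) (u : Matrix (Fin k) (Fin l) F) (y : gl F l)
    (v : Fin (k + l) → F) :
    spl k l (but k l x u y *ᵥ v) =
      (x *ᵥ (spl k l v).1 + u *ᵥ (spl k l v).2, y *ᵥ (spl k l v).2) := by
  refine Prod.ext ?_ ?_
  · rw [spl_fst, mulVec_comp, blk_but, Matrix.fromBlocks_mulVec, spl_fst, spl_snd]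
    rfl
  · rw [spl_snd, mulVec_comp, blk_but, Matrix.fromBlocks_mulVec, spl_snd]
    funext i
    simp

theorem obj_but {k l : ℕ} (x : gl F k) (u : Matrix (Fin k) (Fin l) F) (y : gl F l) :
    IsIso (obj (but k l x u y)) (ext (obj x) (obj y) u.mulVecLin) :=
  ⟨spl k l, fun v => spl_but x u y v⟩

theorem isBUT_iff {k l : ℕ} (m : gl F (k + l)) :
    IsBUT k l m ↔ ∃ u, m = but k l (proj k l m).1 u (proj k l m).2 := by
  constructor
  · intro h
    refine ⟨Matrix.toBlocks₁₂ (blk k l m), ?_⟩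
    have h1 : blk k l m = Matrix.fromBlocks (proj k l m).1 (Matrix.toBlocks₁₂ (blk k l m)) 0
        (proj k l m).2 := by
      conv_lhs => rw [← Matrix.fromBlocks_toBlocks (blk k l m)]
      rw [show Matrix.toBlocks₂₁ (blk k l m) = 0 from h]
      rfl
    unfold but
    rw [← h1]
    simp [blk]
  · rintro ⟨u, hu⟩
    unfold IsBUT
    rw [hu, blk_but]
    simp

end HCPaper
end

section
open Matrix BigOperators
namespace HCPaper
open scoped Classical
variable {F : Type} [Field F]

/-- the standard subspace -/
def sE (F : Type) [Field F] (k l : ℕ) : Submodule F (Fin (k + l) → F) :=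
  LinearMap.ker (LinearMap.snd F (Fin k → F) (Fin l → F) ∘ₗ (spl k l).toLinearMap)

theorem mem_sE {k l : ℕ} (v : Fin (k + l) → F) : v ∈ sE F k l ↔ (spl k l v).2 = 0 := Iff.rfl

def sEequiv (k l : ℕ) : sE F k l ≃ₗ[F] (Fin k → F) where
  toFun v := (spl k l v.1).1
  invFun a := ⟨(spl k l).symm (a, 0), by rw [mem_sE]; simp⟩
  left_inv v := by
    apply Subtype.ext
    apply (spl k l).injective
    rw [LinearEquiv.apply_symm_apply]
    exact Prod.ext rfl ((mem_sE _).1 v.2).symm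
  right_inv a := by simp
  map_add' a b := by simp
  map_smul' c a := by simp

theorem finrank_sE (k l : ℕ) : Module.finrank F (sE F k l) = k :=
  (sEequiv k l).finrank_eq.trans (Module.finrank_fin_fun F)

noncomputable def sQequiv (k l : ℕ) : ((Fin (k + l) → F) ⧸ sE F k l) ≃ₗ[F] (Fin l → F) :=
  LinearMap.quotKerEquivOfSurjective
    (LinearMap.snd F (Fin k → F) (Fin l → F) ∘ₗ (spl k l).toLinearMap)
    (fun b => ⟨(spl k l).symm (0, b), by simp⟩)

variable [Finite F]

theorem spl_gen {k l : ℕ} (m : gl F (k + l)) (v : Fin (k + l) → F) :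
    (spl k l (m *ᵥ v)).2 = (blk k l m).toBlocks₂₁ *ᵥ (spl k l v).1 +
      (blk k l m).toBlocks₂₂ *ᵥ (spl k l v).2 := by
  rw [spl_snd, mulVec_comp]
  conv_lhs => rw [← Matrix.fromBlocks_toBlocks (blk k l m)]
  rw [Matrix.fromBlocks_mulVec]
  rfl

theorem isBUT_stb {k l : ℕ} (m : gl F (k + l)) : IsBUT k l m ↔ Stb (obj m) (sE F k l) := by
  constructor
  · intro h
    have key : ∀ v : Fin (k + l) → F, v ∈ sE F k l → m *ᵥ v ∈ sE F k l := by
      intro v hv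
      rw [mem_sE, spl_gen, (mem_sE _).1 hv, show (blk k l m).toBlocks₂₁ = 0 from h]
      simp
    exact key
  · intro h
    unfold IsBUT
    apply Matrix.mulVec_injective
    funext a
    have h1 := h ((spl k l).symm (a, 0)) ((mem_sE _).2 (by simp))
    rw [obj_x] at h1
    have h2 := (mem_sE _).1 h1
    rw [spl_gen] at h2
    simpa using h2

theorem term_sE {k l : ℕ} {P : Obj F → Obj F → ℂ} (hP : Inv2 P) (m : gl F (k + l)) :
    term P (obj m) (sE F k l) =
      if IsBUT k l m then P (obj (proj k l m).1) (obj (proj k l m).2) else 0 := by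
  split_ifs with h
  · obtain ⟨u, hu⟩ := (isBUT_iff m).1 h
    have hs := (isBUT_stb m).1 h
    have hsp := fun v => spl_but (proj k l m).1 u (proj k l m).2 v
    rw [← hu] at hsp
    rw [term_pos _ _ _ hs]
    apply hP
    · refine ⟨sEequiv k l, fun v => ?_⟩
      have hv : (spl k l v.1).2 = 0 := (mem_sE _).1 v.2
      have := congrArg Prod.fst (hsp v.1)
      simp only [hv, Matrix.mulVec_zero, add_zero] at this
      exact this
    · refine ⟨sQequiv k l, fun v => ?_⟩
      obtain ⟨v, rfl⟩ := Submodule.Quotient.mk_surjective _ v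
      exact congrArg Prod.snd (hsp v)
  · exact term_neg _ _ _ fun hs => h ((isBUT_stb m).2 hs)

/-- pullback of the standard subspace by `g` -/
def pb {k l : ℕ} (g : Matrix.GeneralLinearGroup (Fin (k + l)) F) :
    Submodule F (Fin (k + l) → F) :=
  (sE F k l).comap (gE g).toLinearMap

theorem mem_pb {k l : ℕ} (g : Matrix.GeneralLinearGroup (Fin (k + l)) F) (v : Fin (k + l) → F) :
    v ∈ pb g ↔ gE g v ∈ sE F k l := Iff.rfl

theorem finrank_pb {k l : ℕ} (g : Matrix.GeneralLinearGroup (Fin (k + l)) F) :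
    Module.finrank F (pb g) = k := by
  unfold pb
  have h := Submodule.map_equiv_eq_comap_symm (gE g).symm (sE F k l)
  rw [LinearEquiv.symm_symm] at h
  rw [← h]
  exact (LinearEquiv.finrank_map_eq _ _).trans (finrank_sE k l)

theorem pb_surj {k l : ℕ} (W : Submodule F (Fin (k + l) → F)) (hW : Module.finrank F W = k) :
    ∃ g : Matrix.GeneralLinearGroup (Fin (k + l)) F, pb g = W := by
  have e : W ≃ₗ[F] sE F k l := LinearEquiv.ofFinrankEq _ _ (by rw [hW, finrank_sE])
  obtain ⟨e', he'⟩ := Submodule.exists_linearEquiv_restrict_eq e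
  obtain ⟨g, hg⟩ := gE_surj e'
  refine ⟨g, ?_⟩
  symm
  apply Submodule.eq_of_le_of_finrank_eq
  · intro v hv
    rw [mem_pb, hg, ← he' ⟨v, hv⟩]
    exact (e ⟨v, hv⟩).2
  · rw [hW, finrank_pb]

theorem pb_eq_iff {k l : ℕ} (g g0 : Matrix.GeneralLinearGroup (Fin (k + l)) F) :
    pb g = pb g0 ↔ IsBUT k l ((g * g0⁻¹ : Matrix.GeneralLinearGroup (Fin (k + l)) F) :
      Matrix (Fin (k + l)) (Fin (k + l)) F) := by
  rw [isBUT_stb]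
  have key : ∀ v, gE (g * g0⁻¹) (gE g0 v) = gE g v := by
    intro v
    rw [← gE_mul, inv_mul_cancel_right]
  constructor
  · intro h w hw
    obtain ⟨v, rfl⟩ := (gE g0).surjective w
    have hw' : v ∈ pb g := by
      rw [h]; exact hw
    rw [obj_x, ← gE_apply, key]
    exact hw'
  · intro h
    symm
    apply Submodule.eq_of_le_of_finrank_eq
    · intro v hv
      have := h _ ((mem_pb _ _).1 hv)
      rw [obj_x, ← gE_apply, key] at this
      exact this
    · rw [finrank_pb, finrank_pb]

variable [Fintype F] [DecidableEq F]

theorem fiber_card {k l : ℕ} (W : Submodule F (Fin (k + l) → F)) (hW : Module.finrank F W = k) :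
    Nat.card {g : Matrix.GeneralLinearGroup (Fin (k + l)) F // pb g = W} = Pcard F k l := by
  obtain ⟨g0, rfl⟩ := pb_surj W hW
  refine Nat.card_congr ((Equiv.mulRight g0⁻¹).subtypeEquiv fun g => ?_)
  rw [pb_eq_iff]; rfl

theorem Pcard_ne (k l : ℕ) : (Pcard F k l : ℂ) ≠ 0 := by
  have : Nonempty {g : Matrix.GeneralLinearGroup (Fin (k + l)) F //
    IsBUT k l (g : Matrix (Fin (k + l)) (Fin (k + l)) F)} := by
    refine ⟨1, ?_⟩
    have := (pb_eq_iff (F := F) (k := k) (l := l) 1 1).1 rfl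
    simpa using this
  unfold Pcard
  exact_mod_cast Nat.card_pos.ne'

theorem HCind_gen (k l : ℕ) {H : Obj F → Obj F → ℂ} (hH : Inv2 H) (h : gl F k × gl F l → ℂ)
    (hh : ∀ x y, H (obj x) (obj y) = h (x, y)) (z : gl F (k + l)) :
    HCind k l h z = mulP (fun A B => if Module.finrank F A.V = k then H A B else 0) (obj z) := by
  have hP : Inv2 (fun A B => if Module.finrank F A.V = k then H A B else 0) := by
    intro A A' B B' h1 h2
    simp only [h1.dim, hH _ _ _ _ h1 h2]
  unfold HCind
  split_ifs with hk hl
  · subst hk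
    rw [mulP_eq_bot hP]
    · have h0 : Module.finrank F (zeroO : Obj F).V = 0 :=
        Module.finrank_zero_of_subsingleton (M := PUnit)
      rw [if_pos h0]
      beta_reduce
      rw [← hh]
      exact hH _ _ _ _ (iso_zero (dim_obj _)) (obj_cast _ _)
    · intro W hW hs
      rw [if_neg]
      intro h0
      exact hW (Submodule.finrank_eq_zero.1 h0)
  · subst hl
    rw [mulP_eq_top hP]
    · have h0 : Module.finrank F (obj z).V = k := dim_obj z
      rw [if_pos h0]
      beta_reduce
      rw [← hh]
      exact hH _ _ _ _ (obj_cast _ _) (iso_zero (dim_obj _))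
    · intro W hW hs
      rw [if_neg]
      intro h0
      apply hW
      apply Submodule.eq_top_of_finrank_eq
      exact h0.trans (dim_obj z).symm
  · set P : Obj F → Obj F → ℂ := fun A B => if Module.finrank F A.V = k then H A B else 0 with hPd
    have h1 : ∀ g : Matrix.GeneralLinearGroup (Fin (k + l)) F,
        (if IsBUT k l (conjM g z) then h (proj k l (conjM g z)) else 0) =
          term P (obj z) (pb g) := by
      intro g
      rw [term_map hP (X := obj z) (Y := obj (conjM g z)) (gE g) (fun v => gE_conj g z v)
        (pb g) (sE F k l) (fun v => (mem_pb g v).symm), term_sE hP]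
      split_ifs with hb
      · simp only [hPd]
        rw [if_pos (dim_obj _), hh]
      · rfl
    beta_reduce
    rw [Finset.sum_congr rfl fun g _ => h1 g]
    rw [inv_mul_eq_iff_eq_mul₀ (Pcard_ne k l)]
    unfold mulP
    rw [Finset.mul_sum, ← Finset.sum_fiberwise_of_maps_to (t := Finset.univ)
      (g := fun g : Matrix.GeneralLinearGroup (Fin (k + l)) F => pb g) (fun _ _ => Finset.mem_univ _)]
    refine Finset.sum_congr rfl fun W _ => ?_
    rw [Finset.sum_congr rfl (g := fun _ => term P (obj z) W)
      (fun g hg => by rw [(Finset.mem_filter.1 hg).2])]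
    rw [Finset.sum_const, nsmul_eq_mul]
    by_cases hW : Module.finrank F W = k
    · rw [← fiber_card W hW]
      congr 2
      rw [Nat.card_eq_fintype_card, Fintype.card_subtype]
    · have : term P (obj z) W = 0 := by
        by_cases hs : Stb (obj z) W
        · rw [term_pos _ _ _ hs]
          exact if_neg hW
        · exact term_neg _ _ _ hs
      rw [this, mul_zero, mul_zero]

theorem HCres_gen (k l : ℕ) {f' : Obj F → ℂ} (hf : Inv f') (f : gl F (k + l) → ℂ)
    (hh : ∀ z, f' (obj z) = f z) (x : gl F k) (y : gl F l) :
    HCres k l f (x, y) = Dl f' (obj x) (obj y) := by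
  unfold HCres
  split_ifs with hk hl
  · subst hk
    rw [(Dl_inv hf).fst (iso_zero (dim_obj x)), Dl_zero hf]
    beta_reduce
    rw [← hh]
    exact hf _ _ (obj_cast _ _)
  · subst hl
    rw [(Dl_inv hf).snd (obj x) _ _ (iso_zero (dim_obj y)), Dl_zero' hf]
    beta_reduce
    rw [← hh]
    exact hf _ _ (obj_cast _ _)
  · have : Dl f' (obj x) (obj y) = avg (fun u : Matrix (Fin k) (Fin l) F => f (but k l x u y)) := by
      symm
      refine avg_equiv (Matrix.toLin' (R := F) (m := Fin k) (n := Fin l)).toEquiv _ _ fun u => ?_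
      rw [← hh]
      exact hf _ _ (obj_but x u y)
    rw [this, avg_eq]
    congr 2
    have : Fintype.card (Matrix (Fin k) (Fin l) F) = Fintype.card F ^ (k * l) := by
      rw [Fintype.card_congr (Matrix.of (m := Fin k) (n := Fin l) (α := F)).symm]
      simp [← pow_mul, mul_comm]
    rw [this]; push_cast; rfl

theorem castFun_agree {m n : ℕ} (h : m = n) {f' : Obj F → ℂ} (hf : Inv f') (f : gl F m → ℂ)
    (hh : ∀ z, f' (obj z) = f z) (z : gl F n) : f' (obj z) = castFun h f z := by
  unfold castFun
  rw [← hh]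
  exact hf _ _ (obj_cast _ _).symm

theorem RcompRes_gen (L : List ℕ) : ∀ {f' : Obj F → ℂ} (_ : Inv f') (f : gl F L.sum → ℂ)
    (_ : ∀ z, f' (obj z) = f z) (z : gl F L.sum), RcompRes L f z = Rh L f' (obj z) := by
  induction L with
  | nil => intro f' hf f hh z; exact (hh z).symm
  | cons k L ih =>
    intro f' hf f hh z
    have hH : Inv2 (fun A B => Rh L (Dl f' A) B) := by
      intro A A' B B' h h'
      simp only [(Dl_inv hf).fst h]
      exact Rh_inv L ((Dl_inv hf).snd A') _ _ h'
    rw [RcompRes, castFun, HCind_gen k L.sum hH, Rh]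
    · apply mulP_inv _ _ _ (obj_cast _ _)
      intro A A' B B' h1 h2
      simp only [h1.dim, hH _ _ _ _ h1 h2]
    · intro x y
      symm
      apply ih ((Dl_inv hf).snd _)
      intro y'
      symm
      exact HCres_gen k L.sum hf _ (fun z => castFun_agree _ hf f hh z) x y'

theorem Dual_gen (n : ℕ) {f' : Obj F → ℂ} (hf : Inv f') (f : gl F n → ℂ)
    (hh : ∀ z, f' (obj z) = f z) (z : gl F n) :
    Dual n f z = (-1) ^ n * S f' (obj z) := by
  unfold Dual
  rw [Finset.sum_apply, S_eq f' (obj z) n (dim_obj z), Finset.mul_sum]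
  refine Finset.sum_congr rfl fun c _ => ?_
  rw [Pi.smul_apply, smul_eq_mul, castFun,
    RcompRes_gen c.blocks hf _ (fun z => castFun_agree _ hf f hh z),
    Rh_inv c.blocks hf _ _ (obj_cast _ _), ← mul_assoc]
  congr 1
  have hle : c.length ≤ n := c.length_le
  obtain ⟨d, hd⟩ := Nat.exists_eq_add_of_le hle
  have h1 : ((-1 : ℂ)) ^ (c.length) * (-1) ^ c.length = 1 := by
    rw [← mul_pow]; simp
  have h2 : ((-1 : ℂ)) ^ n = (-1) ^ c.length * (-1) ^ d := by rw [← pow_add, ← hd]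
  rw [show n - c.length = d by omega, h2, mul_assoc, mul_comm _ ((-1 : ℂ) ^ c.length), ← mul_assoc,
    h1, one_mul]

theorem dual_main (n₁ n₂ : ℕ) (f₁ : gl F n₁ → ℂ) (f₂ : gl F n₂ → ℂ)
    (hf₁ : Invariant n₁ f₁) (hf₂ : Invariant n₂ f₂) :
    Dual (n₁ + n₂) (HCind n₁ n₂ fun p => f₁ p.1 * f₂ p.2) =
      HCind n₁ n₂ fun p => Dual n₁ f₁ p.1 * Dual n₂ f₂ p.2 := by
  obtain ⟨g₁, hi₁, ha₁, hz₁⟩ := exists_lift f₁ hf₁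
  obtain ⟨g₂, hi₂, ha₂, hz₂⟩ := exists_lift f₂ hf₂
  funext z
  rw [Dual_gen _ (mul_inv' hi₁ hi₂), S_mul _ hi₁ hi₂ _ rfl]
  · have hS := (S_inv hi₁).mul2 (S_inv hi₂)
    rw [HCind_gen n₁ n₂
      (H := fun A B => (-1) ^ (n₁ + n₂) * (S g₁ A * S g₂ B))]
    · unfold mul
      rw [← mulP_const]
      congr 1
      funext A B
      split_ifs with h
      · rfl
      · rw [S_vanish (Module.finrank F A.V) g₁ (fun X hX => hz₁ X (by rw [hX]; exact h)) A rfl]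
        simp
    · intro A A' B B' h h'
      exact congrArg _ (hS _ _ _ _ h h')
    · intro x y
      rw [Dual_gen _ hi₁ f₁ ha₁, Dual_gen _ hi₂ f₂ ha₂]
      ring
  · intro z
    rw [HCind_gen n₁ n₂ (hi₁.mul2 hi₂)]
    · unfold mul
      congr 1
      funext A B
      split_ifs with h
      · rfl
      · rw [hz₁ A h, zero_mul]
    · intro x y
      rw [ha₁, ha₂]

end HCPaper
end

namespace HCPaper

open scoped Classical

variable {F : Type} [Field F] [Fintype F] [DecidableEq F]

/-- the duality operations commute with Harish-Chandra induction. -/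
theorem dual_commutes_with_HCind (F : Type) [Field F] [Fintype F] [DecidableEq F]
    (n₁ n₂ : ℕ) (h₁ : 1 ≤ n₁) (h₂ : 1 ≤ n₂)
    (f₁ : gl F n₁ → ℂ) (f₂ : gl F n₂ → ℂ)
    (hf₁ : Invariant n₁ f₁) (hf₂ : Invariant n₂ f₂) :
    Dual (n₁ + n₂) (HCind n₁ n₂ fun p => f₁ p.1 * f₂ p.2) =
      HCind n₁ n₂ fun p => Dual n₁ f₁ p.1 * Dual n₂ f₂ p.2 := by
  exact dual_main n₁ n₂ f₁ f₂ hf₁ hf₂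

end HCPaper
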